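/- Suppose E[ξ⁵] < ∞. Then there exists a constant υ > 0 such that the probability under τ_n that the 2-heavy tree has at least υ·n nodes tends to 1 as n → ∞ along n ∈ I. -/

import Mathlib

/-! Finite ordered rooted (plane) trees: a tree is a finite list of its root subtrees. -/
inductive PTree : Type where
  | node : List PTree → PTree

namespace PTree

/-- the number of nodes of the tree -/
def size : PTree → ℕ
  | node ts => 1 + (ts.attach.map (fun x => size x.1)).sum
decreasing_by
  have := List.sizeOf_lt_of_mem x.2
  simp only [node.sizeOf_spec]; omega

/-- the list of all subtrees rooted at the nodes of the tree -/
def subtrees : PTree → List PTree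
  | node ts => node ts :: (ts.attach.map (fun x => subtrees x.1)).flatten
decreasing_by
  have := List.sizeOf_lt_of_mem x.2
  simp only [node.sizeOf_spec]; omega

/-- the height of the tree (maximal distance from the root to a node) -/
def height : PTree → ℕ
  | node ts => (ts.attach.map (fun x => height x.1 + 1)).foldr max 0
decreasing_by
  have := List.sizeOf_lt_of_mem x.2
  simp only [node.sizeOf_spec]; omega

/-- the number of children of the root (`ξ_ε`) -/
def rootDeg : PTree → ℕ
  | node ts => ts.length

/-- the sizes of the subtrees rooted at the children of the root -/
def childSizes : PTree → List ℕ
  | node ts => ts.map size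

/-- the sizes of the subtrees rooted at the children of the root,
sorted from largest to smallest -/
def sortedSizesDesc (T : PTree) : List ℕ :=
  T.childSizes.insertionSort (· ≥ ·)

/-- `N_k`: the `k`-th largest among the sizes of the subtrees rooted at the children
of the root (`0` if there are fewer than `k` children) -/
def Nk (k : ℕ) (T : PTree) : ℕ := (sortedSizesDesc T).getD (k - 1) 0

/-- `N_{k+} = N_k + N_{k+1} + ⋯` -/
def NkPlus (k : ℕ) (T : PTree) : ℕ := ((sortedSizesDesc T).drop (k - 1)).sum

/-- the subtrees rooted at the nodes of the heavy path: starting at the root, always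
continue to the first child of maximal subtree size -/
def heavyPath : PTree → List PTree
  | node ts =>
    node ts ::
      (match ts.attach.find? (fun x => x.1.size = ((ts.map size).foldr max 0)) with
       | some x => heavyPath x.1
       | none => [])
decreasing_by
  have := List.sizeOf_lt_of_mem x.2
  simp only [node.sizeOf_spec]; omega

end PTree

/-- `Z_k`: the number of nodes `v` of the tree whose subtree has size `k` -/
def Zk (k : ℕ) (T : PTree) : ℕ := (T.subtrees.filter (fun s => s.size = k)).length

/-- the rank (`1` = largest) of the `i`-th child (0-based) among siblings whose subtree
sizes are given by the list `sizes`; ties are broken from left to right -/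
def rankIn (sizes : List ℕ) (i : ℕ) : ℕ :=
  1 + ((List.range sizes.length).filter (fun j =>
        sizes.getD i 0 < sizes.getD j 0 ∨ (sizes.getD j 0 = sizes.getD i 0 ∧ j < i))).length

mutual
/-- the number of nodes of the `k`-heavy tree: the root together with all nodes `v` such
that `v` and every non-root ancestor of `v` has rank at most `k` among its siblings -/
def heavySize (k : ℕ) : PTree → ℕ
  | .node ts => 1 + heavySizeAux k (ts.map PTree.size) 0 ts
def heavySizeAux (k : ℕ) (sizes : List ℕ) : ℕ → List PTree → ℕ
  | _, [] => 0
  | i, t :: rest =>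
      (if rankIn sizes i ≤ k then heavySize k t else 0) + heavySizeAux k sizes (i + 1) rest
end

/-- `H*(v,ℓ)`: the height of the subtree rooted at the child of rank `ℓ` of the root of `v`
(`0` if there are fewer than `ℓ` children) -/
def Hstar : PTree → ℕ → ℕ
  | .node ts, ℓ =>
    match (List.range ts.length).find? (fun i => rankIn (ts.map PTree.size) i = ℓ) with
    | some i => (ts.getD i (.node [])).height
    | none => 0

/-- the weight of a tree: the product over all nodes `v` of `p (number of children of v)` -/
noncomputable def weight (p : ℕ → ℝ) : PTree → ℝ
  | .node ts => p ts.length * (ts.attach.map (fun x => weight p x.1)).prod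
decreasing_by
  have := List.sizeOf_lt_of_mem x.2
  simp only [PTree.node.sizeOf_spec]; omega

/-- the total weight of all trees of size `n` -/
noncomputable def treeSum (p : ℕ → ℝ) (n : ℕ) : ℝ :=
  ∑' T : {T : PTree // T.size = n}, weight p T.1

/-- the probability of the event `A` under the conditional Galton-Watson tree `τ_n` -/
noncomputable def condProb (p : ℕ → ℝ) (n : ℕ) (A : PTree → Prop) : ℝ :=
  (∑' T : {T : PTree // T.size = n ∧ A T}, weight p T.1) / treeSum p n

/-- the expectation of `f` under the conditional Galton-Watson tree `τ_n` -/
noncomputable def condExp (p : ℕ → ℝ) (n : ℕ) (f : PTree → ℝ) : ℝ :=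
  (∑' T : {T : PTree // T.size = n}, weight p T.1 * f T.1) / treeSum p n

/-- the variance of `f` under the conditional Galton-Watson tree `τ_n` -/
noncomputable def condVar (p : ℕ → ℝ) (n : ℕ) (f : PTree → ℝ) : ℝ :=
  condExp p n (fun T => f T ^ 2) - (condExp p n f) ^ 2

/-- the set `I = {n ≥ 1 : Σ_{|T| = n} w(T) > 0}` of sizes of positive probability -/
def gwSupport (p : ℕ → ℝ) : Set ℕ := {n | 1 ≤ n ∧ 0 < treeSum p n}

/-- `P(S_m = x)` for the random walk `S_m = (ξ_1 - 1) + ⋯ + (ξ_m - 1)`, `ξ_i` i.i.d. `∼ p` -/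
noncomputable def walkProb (p : ℕ → ℝ) (m : ℕ) (x : ℤ) : ℝ :=
  ∑' a : Fin m → ℕ, if (∑ i, ((a i : ℤ) - 1)) = x then ∏ i, p (a i) else 0

/-- `I_n = {1 ≤ k ≤ n : P(S_{n-k} = 0) > 0}` -/
def walkSupportIn (p : ℕ → ℝ) (n : ℕ) : Set ℕ :=
  {k | 1 ≤ k ∧ k ≤ n ∧ 0 < walkProb p (n - k) 0}

/-- `h = gcd {i > 0 : p_i > 0}`, defined as the largest common divisor of the support -/
noncomputable def gcdSupp (p : ℕ → ℝ) : ℕ :=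
  sSup {d : ℕ | 0 < d ∧ ∀ i : ℕ, 0 < i → 0 < p i → d ∣ i}

/-- `α = h / (σ √(2π))` where `σ² = Σ i² p_i - 1` -/
noncomputable def gwAlpha (p : ℕ → ℝ) : ℝ :=
  (gcdSupp p : ℝ) /
    (Real.sqrt ((∑' i : ℕ, (i : ℝ) ^ 2 * p i) - 1) * Real.sqrt (2 * Real.pi))

/-- the moment `E[ξ^m] = Σ i^m p_i` is finite -/
def MomentFinite (p : ℕ → ℝ) (m : ℝ) : Prop :=
  Summable (fun i : ℕ => (i : ℝ) ^ m * p i)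

open Filter

open scoped ENNReal

/-- The coefficients of the `n`-th power of the generating function of `p`: the law of the sum of
`n` independent variables with law `p`. -/
noncomputable def powCoeff (p : ℕ → ℝ) (n j : ℕ) : ℝ :=
  PowerSeries.coeff j (PowerSeries.mk p ^ n)

/-- The characteristic function of a law on `ℕ`. -/
noncomputable def natCharFun (p : ℕ → ℝ) (t : ℝ) : ℂ :=
  ∑' c : ℕ, (p c : ℂ) * Complex.exp (c * t * Complex.I)

lemma powCoeff_succ (p : ℕ → ℝ) (n j : ℕ) :
    powCoeff p (n + 1) j = ∑ x ∈ Finset.HasAntidiagonal.antidiagonal j, powCoeff p n x.1 * p x.2 := by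
  simp [powCoeff, pow_succ, PowerSeries.coeff_mul]

lemma powCoeff_zero (p : ℕ → ℝ) (j : ℕ) : powCoeff p 0 j = if j = 0 then 1 else 0 := by
  simp [powCoeff, PowerSeries.coeff_one]

lemma powCoeff_nonneg {p : ℕ → ℝ} (hp : ∀ i, 0 ≤ p i) (n j : ℕ) : 0 ≤ powCoeff p n j := by
  induction n generalizing j with
  | zero => rw [powCoeff_zero]; split_ifs <;> norm_num
  | succ n ih =>
    rw [powCoeff_succ]
    exact Finset.sum_nonneg fun x _ => mul_nonneg (ih _) (hp _)

lemma powCoeff_eq_zero {p : ℕ → ℝ} {h : ℕ} (hh : ∀ c, p c ≠ 0 → h ∣ c) {n j : ℕ}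
    (hj : ¬ h ∣ j) : powCoeff p n j = 0 := by
  induction n generalizing j with
  | zero => rw [powCoeff_zero, if_neg]; rintro rfl; exact hj (dvd_zero _)
  | succ n ih =>
    rw [powCoeff_succ]
    refine Finset.sum_eq_zero fun x hx => ?_
    rw [Finset.HasAntidiagonal.mem_antidiagonal] at hx
    by_cases h1 : h ∣ x.1
    · by_cases h2 : p x.2 = 0
      · simp [h2]
      · exact absurd (hx ▸ dvd_add h1 (hh _ h2)) hj
    · simp [ih h1]

lemma norm_exp_nat_mul (c : ℕ) (t : ℝ) : ‖Complex.exp (c * t * Complex.I)‖ = 1 := by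
  rw [show (c * t * Complex.I : ℂ) = ((c * t : ℝ) : ℂ) * Complex.I by push_cast; ring]
  exact Complex.norm_exp_ofReal_mul_I _

lemma norm_mul_exp_nat {p : ℕ → ℝ} (hp : ∀ i, 0 ≤ p i) (c : ℕ) (t : ℝ) :
    ‖(p c : ℂ) * Complex.exp (c * t * Complex.I)‖ = p c := by
  rw [norm_mul, norm_exp_nat_mul, mul_one, Complex.norm_real, Real.norm_of_nonneg (hp c)]

lemma powCoeff_charFun {p : ℕ → ℝ} (hp : ∀ i, 0 ≤ p i) (hs : Summable p) (n : ℕ) (t : ℝ) :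
    Summable (fun j => ‖(powCoeff p n j : ℂ) * Complex.exp (j * t * Complex.I)‖) ∧
      ∑' j, (powCoeff p n j : ℂ) * Complex.exp (j * t * Complex.I) = natCharFun p t ^ n := by
  induction n with
  | zero =>
    constructor
    · refine summable_of_ne_finset_zero (s := {0}) fun b hb => ?_
      simp only [Finset.mem_singleton] at hb
      simp [powCoeff_zero, hb]
    · rw [tsum_eq_single 0]
      · simp [powCoeff_zero]
      · intro b hb
        simp [powCoeff_zero, hb]
  | succ n ih =>
    have h2 : Summable fun c => ‖(p c : ℂ) * Complex.exp (c * t * Complex.I)‖ := by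
      simpa only [norm_mul_exp_nat hp] using hs
    have key : ∀ j, (powCoeff p (n + 1) j : ℂ) * Complex.exp (j * t * Complex.I) =
        ∑ x ∈ Finset.HasAntidiagonal.antidiagonal j, ((powCoeff p n x.1 : ℂ) * Complex.exp (x.1 * t * Complex.I)) *
          ((p x.2 : ℂ) * Complex.exp (x.2 * t * Complex.I)) := by
      intro j
      rw [powCoeff_succ]
      push_cast
      rw [Finset.sum_mul]
      refine Finset.sum_congr rfl fun x hx => ?_
      rw [Finset.HasAntidiagonal.mem_antidiagonal] at hx
      rw [← hx]
      push_cast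
      rw [add_mul, add_mul, Complex.exp_add]
      ring
    simp only [key]
    refine ⟨summable_norm_sum_mul_antidiagonal_of_summable_norm (f := fun j : ℕ => (powCoeff p n j : ℂ) * Complex.exp (j * t * Complex.I)) (g := fun c : ℕ => (p c : ℂ) * Complex.exp (c * t * Complex.I)) ih.1 h2, ?_⟩
    have := tsum_mul_tsum_eq_tsum_sum_antidiagonal_of_summable_norm ih.1 h2
    rw [pow_succ, ← ih.2]
    exact this.symm

lemma summable_powCoeff {p : ℕ → ℝ} (hp : ∀ i, 0 ≤ p i) (hs : Summable p) (n : ℕ) :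
    Summable (powCoeff p n) := by
  have := (powCoeff_charFun hp hs n 0).1
  simpa [abs_of_nonneg (powCoeff_nonneg hp n _)] using this

open Complex in
lemma powCoeff_fourier {p : ℕ → ℝ} (hp : ∀ i, 0 ≤ p i) (hs : Summable p) {h : ℕ} (hh0 : 0 < h)
    (hh : ∀ c, p c ≠ 0 → h ∣ c) (n : ℕ) {j : ℕ} (hj : h ∣ j) :
    ((2 * Real.pi / h : ℝ) : ℂ) * powCoeff p n j =
      ∫ t in (-(Real.pi / h))..(Real.pi / h), natCharFun p t ^ n * exp (-(j * t * I)) := by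
  let f : ℕ → C(ℝ, ℂ) := fun k =>
    ⟨fun t => ((powCoeff p n k : ℂ) * exp (k * t * I)) * exp (-(j * t * I)), by fun_prop⟩
  have hn : ∀ k (t : ℝ), ‖f k t‖ = powCoeff p n k := by
    intro k t
    simp only [f, ContinuousMap.coe_mk]
    rw [norm_mul, norm_mul, norm_exp_nat_mul, Complex.exp_neg, norm_inv, norm_exp_nat_mul,
      Complex.norm_real, Real.norm_of_nonneg (powCoeff_nonneg hp n k)]
    simp
  have hsum : Summable fun k => ‖(f k).restrict
      (⟨Set.uIcc (-(Real.pi / h)) (Real.pi / h), isCompact_uIcc⟩ : TopologicalSpace.Compacts ℝ)‖ := by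
    refine Summable.of_nonneg_of_le (fun _ => norm_nonneg _) (fun k => ?_)
      (summable_powCoeff hp hs n)
    rw [ContinuousMap.norm_le _ (powCoeff_nonneg hp n k)]
    intro x
    exact (hn k x).le
  have H := intervalIntegral.tsum_intervalIntegral_eq_of_summable_norm hsum
  have hterm : ∀ k, (∫ t in (-(Real.pi / h))..(Real.pi / h), f k t) =
      if k = j then ((2 * Real.pi / h : ℝ) : ℂ) * powCoeff p n j else 0 := by
    intro k
    have e : ∀ t : ℝ, f k t = (powCoeff p n k : ℂ) * exp ((((k:ℂ) - j) * I) * t) := by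
      intro t
      simp only [f, ContinuousMap.coe_mk]
      rw [mul_assoc, ← Complex.exp_add]
      ring_nf
    simp only [e, intervalIntegral.integral_const_mul]
    split_ifs with hkj
    · subst hkj
      simp
      ring
    · by_cases hk : h ∣ k
      · obtain ⟨a, rfl⟩ := hk
        obtain ⟨b, rfl⟩ := hj
        have hc : ((((h * a : ℕ) : ℂ) - (h * b : ℕ)) * I) ≠ 0 := by
          refine mul_ne_zero (sub_ne_zero.2 ?_) I_ne_zero
          exact_mod_cast hkj
        rw [integral_exp_mul_complex hc]
        have hh' : (h : ℂ) ≠ 0 := by exact_mod_cast hh0.ne'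
        have : exp ((((h * a : ℕ) : ℂ) - (h * b : ℕ)) * I * ((Real.pi / h : ℝ) : ℂ)) =
            exp ((((h * a : ℕ) : ℂ) - (h * b : ℕ)) * I * ((-(Real.pi / h) : ℝ) : ℂ)) := by
          rw [Complex.exp_eq_exp_iff_exists_int]
          refine ⟨a - b, ?_⟩
          push_cast
          field_simp
          ring
        rw [this]
        simp
      · rw [powCoeff_eq_zero hh hk]
        simp
  simp only [hterm, tsum_ite_eq] at H
  rw [H]
  refine intervalIntegral.integral_congr fun t _ => ?_
  simp only [f, ContinuousMap.coe_mk]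
  rw [tsum_mul_right, (powCoeff_charFun hp hs n t).2]

lemma continuous_natCharFun {p : ℕ → ℝ} (hp : ∀ i, 0 ≤ p i) (hs : Summable p) :
    Continuous (natCharFun p) := by
  refine continuous_tsum (u := p) (fun c => by fun_prop) hs fun c t => ?_
  rw [norm_mul_exp_nat hp]

lemma norm_natCharFun_le_pair {p : ℕ → ℝ} (hp : ∀ i, 0 ≤ p i) (hs : HasSum p 1) {b : ℕ}
    (hb : b ≠ 0) (t : ℝ) :
    ‖natCharFun p t‖ ≤ ‖(p 0 : ℂ) + p b * Complex.exp (b * t * Complex.I)‖ + (1 - (p 0 + p b)) := by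
  have hsum : Summable fun c : ℕ => ‖(p c : ℂ) * Complex.exp (c * t * Complex.I)‖ := by
    simpa only [norm_mul_exp_nat hp] using hs.summable
  have e1 : natCharFun p t = ∑ c ∈ ({0, b} : Finset ℕ), (p c : ℂ) * Complex.exp (c * t * Complex.I)
      + ∑' c : ((({0, b} : Finset ℕ) : Set ℕ)ᶜ : Set ℕ),
        (p c : ℂ) * Complex.exp (c * t * Complex.I) :=
    (hsum.of_norm.sum_add_tsum_compl (s := {0, b})).symm
  have e2 : (1 : ℝ) = ∑ c ∈ ({0, b} : Finset ℕ), p c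
      + ∑' c : ((({0, b} : Finset ℕ) : Set ℕ)ᶜ : Set ℕ), p c :=
    hs.tsum_eq.symm.trans (hs.summable.sum_add_tsum_compl (s := {0, b})).symm
  rw [Finset.sum_pair hb.symm] at e1 e2
  have e3 : ‖∑' c : ((({0, b} : Finset ℕ) : Set ℕ)ᶜ : Set ℕ),
      (p c : ℂ) * Complex.exp (c * t * Complex.I)‖ ≤
      ∑' c : ((({0, b} : Finset ℕ) : Set ℕ)ᶜ : Set ℕ), p c := by
    refine (norm_tsum_le_tsum_norm (hsum.subtype _)).trans (le_of_eq ?_)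
    exact tsum_congr fun c => norm_mul_exp_nat hp _ _
  rw [e1]
  refine (norm_add_le _ _).trans ?_
  simp only [Nat.cast_zero, zero_mul, Complex.exp_zero, mul_one]
  linarith

lemma norm_add_mul_exp_sq (x y : ℝ) (b : ℕ) (t : ℝ) :
    ‖(x : ℂ) + y * Complex.exp (b * t * Complex.I)‖ ^ 2 =
      (x + y) ^ 2 - 4 * x * y * Real.sin (b * t / 2) ^ 2 := by
  have : (x : ℂ) + y * Complex.exp (b * t * Complex.I) =
      ((x + y * Real.cos (b * t) : ℝ) : ℂ) + ((y * Real.sin (b * t) : ℝ) : ℂ) * Complex.I := by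
    rw [show (b * t * Complex.I : ℂ) = ((b * t : ℝ) : ℂ) * Complex.I by push_cast; ring,
      Complex.exp_mul_I]
    push_cast
    ring
  rw [this, Complex.sq_norm, Complex.normSq_add_mul_I]
  have h1 := Real.sin_sq_add_cos_sq (b * t)
  have h2 : Real.cos (b * t) = 1 - 2 * Real.sin (b * t / 2) ^ 2 := by
    have h3 := Real.cos_two_mul (b * t / 2)
    have h4 := Real.sin_sq_add_cos_sq (b * t / 2)
    rw [show 2 * ((b:ℝ) * t / 2) = b * t by ring] at h3
    linarith
  have h5 : Real.sin (b * t) ^ 2 = 1 - (1 - 2 * Real.sin (b * t / 2) ^ 2) ^ 2 := by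
    rw [← h2]; linarith
  rw [mul_pow, h5, h2]
  ring

lemma norm_natCharFun_le_of_small {p : ℕ → ℝ} (hp : ∀ i, 0 ≤ p i) (hs : HasSum p 1)
    (h0 : 0 < p 0) {b : ℕ} (hb : b ≠ 0) (hpb : 0 < p b) {t : ℝ} (ht : |t| ≤ Real.pi / b) :
    ‖natCharFun p t‖ ≤
      Real.exp (-(2 * p 0 * p b / (p 0 + p b) * (b / Real.pi) ^ 2) * t ^ 2) := by
  have hb' : (0 : ℝ) < b := by positivity
  have h1 := norm_natCharFun_le_pair hp hs hb t
  have h2 := norm_add_mul_exp_sq (p 0) (p b) b t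
  set y := ‖(p 0 : ℂ) + p b * Complex.exp (b * t * Complex.I)‖ with hy
  have hsin : (b * |t| / Real.pi) ^ 2 ≤ Real.sin (b * t / 2) ^ 2 := by
    have h3 : 2 / Real.pi * (b * |t| / 2) ≤ Real.sin (b * |t| / 2) := by
      refine Real.mul_le_sin (by positivity) ?_
      rw [le_div_iff₀ hb'] at ht
      linarith
    have h4 : Real.sin (b * |t| / 2) ^ 2 = Real.sin (b * t / 2) ^ 2 := by
      rcases abs_choice t with h | h <;> rw [h]
      rw [show (b : ℝ) * -t / 2 = -(b * t / 2) by ring, Real.sin_neg, neg_sq]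
    rw [← h4]
    refine pow_le_pow_left₀ (by positivity) (le_trans (le_of_eq ?_) h3) 2
    field_simp
  have hA : 0 < p 0 + p b := by positivity
  have h5 : y ≤ (p 0 + p b) - 2 * p 0 * p b / (p 0 + p b) * (b * |t| / Real.pi) ^ 2 := by
    have h6 : y ≤ (p 0 + p b) - 2 * p 0 * p b / (p 0 + p b) * Real.sin (b * t / 2) ^ 2 := by
      have : 2 * (p 0 + p b) * y ≤ (p 0 + p b) ^ 2 + y ^ 2 := by nlinarith [sq_nonneg (p 0 + p b - y)]
      rw [h2] at this
      have : (p 0 + p b) * y ≤ (p 0 + p b) *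
          ((p 0 + p b) - 2 * p 0 * p b / (p 0 + p b) * Real.sin (b * t / 2) ^ 2) := by
        have e : (p 0 + p b) *
          ((p 0 + p b) - 2 * p 0 * p b / (p 0 + p b) * Real.sin (b * t / 2) ^ 2) =
          (p 0 + p b) ^ 2 - 2 * p 0 * p b * Real.sin (b * t / 2) ^ 2 := by
          field_simp
        rw [e]
        linarith
      exact le_of_mul_le_mul_left this hA
    have : 0 ≤ 2 * p 0 * p b / (p 0 + p b) := by positivity
    nlinarith
  have h7 := Real.add_one_le_exp (-(2 * p 0 * p b / (p 0 + p b) * (b / Real.pi) ^ 2) * t ^ 2)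
  have h8 : (b * |t| / Real.pi) ^ 2 = (b / Real.pi) ^ 2 * t ^ 2 := by
    rw [← sq_abs t]; ring
  rw [h8] at h5
  linarith

lemma exists_gcd_generator (s : Set ℕ) :
    ∃ h : ℕ, (∀ c ∈ s, h ∣ c) ∧ (h : ℤ) ∈ AddSubgroup.closure ((fun c : ℕ => (c : ℤ)) '' s) := by
  obtain ⟨a, ha⟩ := Int.subgroup_cyclic (AddSubgroup.closure ((fun c : ℕ => (c : ℤ)) '' s))
  rw [← AddSubgroup.zmultiples_eq_closure] at ha
  refine ⟨a.natAbs, fun c hc => ?_, ?_⟩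
  · have : (c : ℤ) ∈ AddSubgroup.zmultiples a := by
      rw [← ha]; exact AddSubgroup.subset_closure ⟨c, hc, rfl⟩
    rw [Int.mem_zmultiples_iff] at this
    exact Int.natAbs_dvd_natAbs.2 this
  · rw [ha, Int.mem_zmultiples_iff]
    exact Int.dvd_natAbs.2 dvd_rfl

lemma norm_natCharFun_lt_one {p : ℕ → ℝ} (hp : ∀ i, 0 ≤ p i) (hs : HasSum p 1)
    (h0 : 0 < p 0) {h : ℕ} (hh0 : 0 < h)
    (hh : (h : ℤ) ∈ AddSubgroup.closure ((fun c : ℕ => (c : ℤ)) '' {c | p c ≠ 0}))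
    {t : ℝ} (ht0 : t ≠ 0) (ht : |t| ≤ Real.pi / h) : ‖natCharFun p t‖ < 1 := by
  by_contra! hcon
  let H : AddSubgroup ℤ :=
    (AddSubgroup.zmultiples (2 * Real.pi)).comap ((AddMonoidHom.mulRight t).comp (Int.castAddHom ℝ))
  have hH : AddSubgroup.closure ((fun c : ℕ => (c : ℤ)) '' {c | p c ≠ 0}) ≤ H := by
    rw [AddSubgroup.closure_le]
    rintro _ ⟨c, hc, rfl⟩
    rw [SetLike.mem_coe, AddSubgroup.mem_comap]
    rcases eq_or_ne c 0 with rfl | hc0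
    · simp
    have hpc : 0 < p c := lt_of_le_of_ne (hp c) (Ne.symm hc)
    have h1 := norm_natCharFun_le_pair hp hs hc0 t
    have h2 := norm_add_mul_exp_sq (p 0) (p c) c t
    set y := ‖(p 0 : ℂ) + p c * Complex.exp (c * t * Complex.I)‖
    have h3 : p 0 + p c ≤ y := by linarith
    have h4 : 4 * p 0 * p c * Real.sin (c * t / 2) ^ 2 ≤ 0 := by nlinarith
    have h5 : Real.sin (c * t / 2) = 0 := by
      by_contra hne
      have : 0 < Real.sin (c * t / 2) ^ 2 := by positivity
      have : 0 < 4 * p 0 * p c * Real.sin (c * t / 2) ^ 2 := by positivity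
      linarith
    obtain ⟨k, hk⟩ := Real.sin_eq_zero_iff.1 h5
    refine AddSubgroup.mem_zmultiples_iff.2 ⟨k, ?_⟩
    simp
    linarith
  have hmem := hH hh
  obtain ⟨k, hk⟩ := AddSubgroup.mem_zmultiples_iff.1 (AddSubgroup.mem_comap.1 hmem)
  simp at hk
  have hh0' : (0 : ℝ) < h := by exact_mod_cast hh0
  rw [le_div_iff₀ hh0'] at ht
  have h6 : |(k : ℝ)| * (2 * Real.pi) ≤ Real.pi := by
    rw [← abs_of_pos (show (0 : ℝ) < 2 * Real.pi by positivity), ← abs_mul, hk, abs_mul,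
      abs_of_pos hh0']
    rw [mul_comm]; exact ht
  have h7 : |(k : ℝ)| < 1 := by
    have := Real.pi_pos
    by_contra! h8
    nlinarith
  have h8 : k = 0 := by
    rw [← Int.abs_lt_one_iff]
    exact_mod_cast h7
  rw [h8] at hk
  simp at hk
  rcases hk with hk | hk
  · exact hh0.ne' hk
  · exact ht0 hk

lemma exists_norm_natCharFun_le_exp {p : ℕ → ℝ} (hp : ∀ i, 0 ≤ p i) (hs : HasSum p 1)
    (h0 : 0 < p 0) {b : ℕ} (hb : b ≠ 0) (hpb : 0 < p b) :
    ∃ h : ℕ, 0 < h ∧ (∀ c, p c ≠ 0 → h ∣ c) ∧ ∃ κ : ℝ, 0 < κ ∧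
      ∀ t : ℝ, |t| ≤ Real.pi / h → ‖natCharFun p t‖ ≤ Real.exp (-κ * t ^ 2) := by
  obtain ⟨h, h1, h2⟩ := exists_gcd_generator {c | p c ≠ 0}
  have hh0 : 0 < h := Nat.pos_of_dvd_of_pos (h1 b hpb.ne') (Nat.pos_of_ne_zero hb)
  refine ⟨h, hh0, h1, ?_⟩
  have hb' : (0 : ℝ) < b := by positivity
  have hh' : (0 : ℝ) < h := by positivity
  have hK : IsCompact (Metric.closedBall (0 : ℝ) (Real.pi / h) ∩ {t : ℝ | Real.pi / b ≤ |t|}) :=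
    (isCompact_closedBall _ _).inter_right (isClosed_le continuous_const continuous_abs)
  obtain ⟨ρ, hρ1, hρ⟩ : ∃ ρ : ℝ, ρ < 1 ∧ ∀ t : ℝ, |t| ≤ Real.pi / h → Real.pi / b ≤ |t| →
      ‖natCharFun p t‖ ≤ ρ := by
    have hne : (Metric.closedBall (0 : ℝ) (Real.pi / h) ∩ {t : ℝ | Real.pi / b ≤ |t|}).Nonempty := by
      refine ⟨Real.pi / b, ?_, ?_⟩
      · rw [mem_closedBall_zero_iff, Real.norm_of_nonneg (by positivity)]
        have : (h : ℝ) ≤ b := by exact_mod_cast Nat.le_of_dvd (Nat.pos_of_ne_zero hb) (h1 b hpb.ne')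
        gcongr
      · exact le_abs_self (Real.pi / b)
    obtain ⟨t0, ht0, hmax⟩ := hK.exists_isMaxOn hne
      (continuous_natCharFun hp hs.summable).norm.continuousOn
    refine ⟨‖natCharFun p t0‖, ?_, fun t h3 h4 => hmax ⟨by simpa using h3, h4⟩⟩
    refine norm_natCharFun_lt_one hp hs h0 hh0 h2 ?_ (by simpa using ht0.1)
    have h3 : 0 < |t0| := lt_of_lt_of_le (by positivity : 0 < Real.pi / b) ht0.2
    intro h4
    simp [h4] at h3
  set κ₁ := 2 * p 0 * p b / (p 0 + p b) * (b / Real.pi) ^ 2 with hκ₁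
  have hκ₁0 : 0 < κ₁ := by positivity
  set κ₂ := (1 - ρ) / (Real.pi / h) ^ 2 with hκ₂
  have hκ₂0 : 0 < κ₂ := by
    have : 0 < 1 - ρ := by linarith
    positivity
  refine ⟨min κ₁ κ₂, lt_min hκ₁0 hκ₂0, fun t ht => ?_⟩
  rcases le_total |t| (Real.pi / b) with h3 | h3
  · refine (norm_natCharFun_le_of_small hp hs h0 hb hpb h3).trans (Real.exp_le_exp.2 ?_)
    have := min_le_left κ₁ κ₂
    nlinarith [sq_nonneg t]
  · refine (hρ t ht h3).trans ?_
    have h4 : t ^ 2 ≤ (Real.pi / h) ^ 2 := by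
      rw [← sq_abs t]
      exact pow_le_pow_left₀ (abs_nonneg t) ht 2
    have h5 : κ₂ * (Real.pi / h) ^ 2 = 1 - ρ := by
      rw [hκ₂]; field_simp
    have h6 := Real.add_one_le_exp (-min κ₁ κ₂ * t ^ 2)
    have h7 := min_le_right κ₁ κ₂
    have h8 : 0 < min κ₁ κ₂ := lt_min hκ₁0 hκ₂0
    have h9 : min κ₁ κ₂ * t ^ 2 ≤ κ₂ * (Real.pi / h) ^ 2 := by gcongr
    linarith

lemma norm_exp_neg_nat_mul (c : ℕ) (t : ℝ) : ‖Complex.exp (-(c * t * Complex.I))‖ = 1 := by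
  rw [Complex.exp_neg, norm_inv, norm_exp_nat_mul, inv_one]

lemma exists_powCoeff_le {p : ℕ → ℝ} (hp : ∀ i, 0 ≤ p i) (hs : HasSum p 1) {h : ℕ} (hh0 : 0 < h)
    (hh : ∀ c, p c ≠ 0 → h ∣ c) {κ : ℝ} (hκ : 0 < κ)
    (hφ : ∀ t : ℝ, |t| ≤ Real.pi / h → ‖natCharFun p t‖ ≤ Real.exp (-κ * t ^ 2)) :
    ∃ C : ℝ, 0 < C ∧ ∀ n j : ℕ, 1 ≤ n → powCoeff p n j ≤ C / Real.sqrt n := by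
  have hh' : (0 : ℝ) < h := by exact_mod_cast hh0
  refine ⟨h / (2 * Real.pi) * Real.sqrt (Real.pi / κ), by positivity, fun n j hn => ?_⟩
  have hn' : (0 : ℝ) < n := by exact_mod_cast hn
  by_cases hj : h ∣ j
  swap
  · rw [powCoeff_eq_zero hh hj]; positivity
  have h1 := powCoeff_fourier hp hs.summable hh0 hh n hj
  have hle : -(Real.pi / h) ≤ Real.pi / h := by
    have : 0 < Real.pi / h := by positivity
    linarith
  have h2 : ‖∫ t in (-(Real.pi / h))..(Real.pi / h),
      natCharFun p t ^ n * Complex.exp (-(j * t * Complex.I))‖ ≤ Real.sqrt (Real.pi / (n * κ)) := by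
    calc _ ≤ ∫ t in (-(Real.pi / h))..(Real.pi / h), Real.exp (-(n * κ) * t ^ 2) := by
          refine intervalIntegral.norm_integral_le_of_norm_le hle ?_ ?_
          · refine Eventually.of_forall fun t ht => ?_
            rw [norm_mul, norm_exp_neg_nat_mul, mul_one, norm_pow]
            refine (pow_le_pow_left₀ (norm_nonneg _) (hφ t (abs_le.2 ⟨ht.1.le, ht.2⟩)) n).trans ?_
            rw [← Real.exp_nat_mul]
            apply le_of_eq; ring_nf
          · exact Continuous.intervalIntegrable (by fun_prop) _ _
      _ ≤ ∫ t : ℝ, Real.exp (-(n * κ) * t ^ 2) := by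
          rw [intervalIntegral.integral_of_le hle]
          exact MeasureTheory.setIntegral_le_integral (integrable_exp_neg_mul_sq (by positivity))
            (Eventually.of_forall fun t => (Real.exp_pos _).le)
      _ = _ := integral_gaussian _
  rw [← h1, norm_mul, Complex.norm_real, Complex.norm_real,
    Real.norm_of_nonneg (by positivity), Real.norm_of_nonneg (powCoeff_nonneg hp n j)] at h2
  have h3 : Real.sqrt (Real.pi / (n * κ)) = Real.sqrt (Real.pi / κ) / Real.sqrt n := by
    rw [← Real.sqrt_div (by positivity)]
    congr 1
    field_simp
  rw [h3] at h2
  rw [mul_div_assoc]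
  have h4 : powCoeff p n j = h / (2 * Real.pi) * (2 * Real.pi / h * powCoeff p n j) := by
    field_simp
  rw [h4]
  gcongr

open Complex in
lemma tendsto_natCharFun_pow {p : ℕ → ℝ} (hp : ∀ i, 0 ≤ p i) (hs : HasSum p 1)
    (hmean : HasSum (fun i : ℕ => (i : ℝ) * p i) 1) {σ : ℝ} (hσ : 0 < σ)
    (hvar : HasSum (fun i : ℕ => (i : ℝ) ^ 2 * p i) (1 + σ ^ 2)) (s : ℝ) :
    Tendsto (fun n : ℕ => (natCharFun p (s / Real.sqrt n) * exp (-((s / Real.sqrt n : ℝ) * I))) ^ n)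
      atTop (nhds (exp (-(σ * s : ℝ) ^ 2 / 2))) := by
  have hs' : HasSum (fun i => ENNReal.ofReal (p i)) 1 := by
    rw [← ENNReal.ofReal_one, ← hs.tsum_eq, ENNReal.ofReal_tsum_of_nonneg hp hs.summable]
    exact ENNReal.summable.hasSum
  let P : PMF ℕ := ⟨fun i => ENNReal.ofReal (p i), hs'⟩
  have hP : ∀ i, (P i).toReal = p i := fun i => ENNReal.toReal_ofReal (hp i)
  let X : ℕ → ℝ := fun c => ((c : ℝ) - 1) / σ
  have hI : ∀ f : ℕ → ℝ, Summable (fun i => p i * f i) → MeasureTheory.Integrable f P.toMeasure := by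
    intro f hf
    rw [← MeasureTheory.integrable_norm_iff (by fun_prop)]
    refine ⟨by fun_prop, ?_⟩
    rw [MeasureTheory.hasFiniteIntegral_iff_norm]
    rw [MeasureTheory.lintegral_countable']
    have : ∀ a, ENNReal.ofReal ‖‖f a‖‖ * P.toMeasure {a} = ENNReal.ofReal (|p a * f a|) := by
      intro a
      rw [PMF.toMeasure_apply_singleton _ _ (by measurability)]
      change _ * ENNReal.ofReal (p a) = _
      rw [← ENNReal.ofReal_mul (by positivity), abs_mul, abs_of_nonneg (hp a), norm_norm, mul_comm]
      rfl
    simp only [this]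
    rw [← ENNReal.ofReal_tsum_of_nonneg (fun _ => abs_nonneg _) hf.abs]
    exact ENNReal.ofReal_lt_top
  have hE : ∀ (f : ℕ → ℝ) (a : ℝ), HasSum (fun i => p i * f i) a → ∫ x, f x ∂P.toMeasure = a := by
    intro f a hf
    rw [PMF.integral_eq_tsum _ _ (hI f hf.summable)]
    simpa [hP] using hf.tsum_eq
  have m1 : ∫ x, X x ∂P.toMeasure = 0 := by
    refine hE _ _ ?_
    have := (hmean.sub hs).div_const σ
    rw [sub_self, zero_div] at this
    refine (congrArg (HasSum · 0) (funext fun i => ?_)).mp this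
    simp only [X]; ring
  have m2 : ∫ x, (X ^ 2) x ∂P.toMeasure = 1 := by
    refine hE _ _ ?_
    have := ((hvar.sub (hmean.mul_left 2)).add hs).div_const (σ ^ 2)
    rw [show (1 + σ ^ 2 - 2 * 1 + 1) / σ ^ 2 = 1 by field_simp; ring] at this
    refine (congrArg (HasSum · 1) (funext fun i => ?_)).mp this
    simp only [X, Pi.pow_apply]; field_simp; ring
  have H := ProbabilityTheory.tendsto_charFun_inv_sqrt_mul_pow (P := P.toMeasure) (X := X)
    (by fun_prop) m1 m2 (σ * s)
  refine H.congr fun n => ?_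
  congr 1
  rw [MeasureTheory.charFun_apply_real, MeasureTheory.integral_map (by fun_prop) (by fun_prop),
    PMF.integral_eq_tsum]
  · rw [natCharFun, ← tsum_mul_right]
    refine tsum_congr fun c => ?_
    rw [hP, Complex.real_smul, mul_assoc (p c : ℂ), ← Complex.exp_add]
    congr 2
    simp only [X]
    push_cast
    have : (σ : ℂ) ≠ 0 := by exact_mod_cast hσ.ne'
    field_simp
    ring
  · refine (MeasureTheory.integrable_const (1 : ℝ)).mono' (by fun_prop) ?_
    refine Eventually.of_forall fun x => ?_
    rw [← Complex.ofReal_mul, Complex.norm_exp_ofReal_mul_I]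

open Complex in
lemma exists_le_powCoeff {p : ℕ → ℝ} (hp : ∀ i, 0 ≤ p i) (hs : HasSum p 1)
    (hmean : HasSum (fun i : ℕ => (i : ℝ) * p i) 1) {σ : ℝ} (hσ : 0 < σ)
    (hvar : HasSum (fun i : ℕ => (i : ℝ) ^ 2 * p i) (1 + σ ^ 2)) {h : ℕ} (hh0 : 0 < h)
    (hh : ∀ c, p c ≠ 0 → h ∣ c) {κ : ℝ} (hκ : 0 < κ)
    (hφ : ∀ t : ℝ, |t| ≤ Real.pi / h → ‖natCharFun p t‖ ≤ Real.exp (-κ * t ^ 2)) :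
    ∃ c : ℝ, 0 < c ∧ ∀ᶠ n : ℕ in atTop, h ∣ n - 1 →
      c / Real.sqrt n ≤ powCoeff p n (n - 1) := by
  have hh' : (0 : ℝ) < h := by exact_mod_cast hh0
  let j : ℕ → ℕ := fun n => h * ((n - 1) / h)
  have hj : ∀ n, |(j n : ℝ) - n| ≤ h + 1 := by
    intro n
    have h1 := Nat.div_add_mod (n - 1) h
    have h2 := Nat.mod_lt (n - 1) hh0
    have h3 : j n ≤ n := by simp only [j]; omega
    have h4 : n ≤ j n + (h + 1) := by simp only [j]; omega
    have h3' : (j n : ℝ) ≤ n := by exact_mod_cast h3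
    have h4' : (n : ℝ) ≤ j n + (h + 1) := by exact_mod_cast h4
    rw [abs_le]; constructor <;> linarith
  let g : ℕ → ℝ → ℂ := fun n s =>
    natCharFun p (s / Real.sqrt n) ^ n * exp (-(j n * (s / Real.sqrt n : ℝ) * I))
  let S : ℕ → Set ℝ := fun n =>
    Set.Ioc (Real.sqrt n * -(Real.pi / h)) (Real.sqrt n * (Real.pi / h))
  have hcont : ∀ n, Continuous (g n) := by
    intro n
    have := continuous_natCharFun hp hs.summable
    fun_prop
  have hsqrt : Tendsto (fun n : ℕ => Real.sqrt n) atTop atTop :=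
    Real.tendsto_sqrt_atTop.comp tendsto_natCast_atTop_atTop
  have key : Tendsto (fun n => ∫ s, (S n).indicator (g n) s) atTop
      (nhds (∫ s : ℝ, exp (-(σ * s : ℝ) ^ 2 / 2))) := by
    refine MeasureTheory.tendsto_integral_of_dominated_convergence
      (fun s => Real.exp (-κ * s ^ 2)) ?_ (integrable_exp_neg_mul_sq hκ) ?_ ?_
    · intro n
      exact ((hcont n).measurable.indicator measurableSet_Ioc).aestronglyMeasurable
    · intro n
      refine Eventually.of_forall fun s => ?_
      by_cases hsS : s ∈ S n
      swap
      · rw [Set.indicator_of_notMem hsS, norm_zero]; positivity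
      rw [Set.indicator_of_mem hsS]
      rcases Nat.eq_zero_or_pos n with rfl | hn
      · simp [S] at hsS
      have hn' : (0 : ℝ) < n := by exact_mod_cast hn
      have hsn : 0 < Real.sqrt n := Real.sqrt_pos.2 hn'
      simp only [g]
      rw [norm_mul, norm_exp_neg_nat_mul, mul_one, norm_pow]
      have h1 : |s / Real.sqrt n| ≤ Real.pi / h := by
        rw [abs_div, abs_of_pos hsn, div_le_iff₀ hsn, abs_le]
        constructor
        · linarith [hsS.1]
        · linarith [hsS.2]
      refine (pow_le_pow_left₀ (norm_nonneg _) (hφ _ h1) n).trans ?_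
      rw [← Real.exp_nat_mul, div_pow, Real.sq_sqrt hn'.le]
      apply le_of_eq; congr 1; field_simp
    · refine Eventually.of_forall fun s => ?_
      have e1 : Tendsto (fun n : ℕ => exp ((-(((j n : ℝ) - n) * (s / Real.sqrt n)) : ℝ) * I)) atTop
          (nhds 1) := by
        have h0 : Tendsto (fun n : ℕ => -(((j n : ℝ) - n) * (s / Real.sqrt n))) atTop (nhds 0) := by
          rw [tendsto_zero_iff_abs_tendsto_zero]
          have h1 : Tendsto (fun n : ℕ => ((h : ℝ) + 1) * (|s| / Real.sqrt n)) atTop (nhds 0) := by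
            rw [← mul_zero ((h : ℝ) + 1)]
            exact (hsqrt.const_div_atTop _).const_mul _
          refine squeeze_zero (fun _ => abs_nonneg _) (fun n => ?_) h1
          simp only [Function.comp]
          rw [abs_neg, abs_mul, abs_div, abs_of_nonneg (Real.sqrt_nonneg n)]
          exact mul_le_mul_of_nonneg_right (hj n) (by positivity)
        have h2 : Continuous fun x : ℝ => exp ((x : ℂ) * I) := by fun_prop
        have h3 := (h2.tendsto 0).comp h0
        rwa [Complex.ofReal_zero, zero_mul, Complex.exp_zero] at h3
      have e2 := (tendsto_natCharFun_pow hp hs hmean hσ hvar s).mul e1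
      rw [mul_one] at e2
      refine e2.congr' ?_
      have e3 : ∀ᶠ n : ℕ in atTop, s ∈ S n := by
        have h1 : Tendsto (fun n : ℕ => Real.sqrt n * (Real.pi / h)) atTop atTop :=
          hsqrt.atTop_mul_const (by positivity)
        filter_upwards [h1.eventually_gt_atTop |s|] with n hn
        have := abs_lt.1 hn
        exact ⟨by linarith, by linarith⟩
      filter_upwards [e3] with n hn
      rw [Set.indicator_of_mem hn]
      simp only [g]
      rw [mul_pow, mul_assoc, ← Complex.exp_nat_mul, ← Complex.exp_add]
      congr 2
      push_cast
      ring
  have hlim : (∫ s : ℝ, exp (-(σ * s : ℝ) ^ 2 / 2)) =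
      ((Real.sqrt (Real.pi / (σ ^ 2 / 2)) : ℝ) : ℂ) := by
    rw [← integral_gaussian, ← integral_complex_ofReal]
    refine MeasureTheory.integral_congr_ae (Eventually.of_forall fun s => ?_)
    push_cast
    ring_nf
  have hval : ∀ n : ℕ, 1 ≤ n → ∫ s, (S n).indicator (g n) s =
      ((Real.sqrt n * (2 * Real.pi / h * powCoeff p n (j n)) : ℝ) : ℂ) := by
    intro n hn
    have hn' : (0 : ℝ) < n := by exact_mod_cast hn
    have hsn : 0 < Real.sqrt n := Real.sqrt_pos.2 hn'
    have h1 := powCoeff_fourier hp hs.summable hh0 hh n (j := j n) ⟨_, rfl⟩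
    rw [MeasureTheory.integral_indicator measurableSet_Ioc, ← intervalIntegral.integral_of_le]
    · have h2 := intervalIntegral.integral_comp_div (a := Real.sqrt n * -(Real.pi / h))
        (b := Real.sqrt n * (Real.pi / h))
        (fun t : ℝ => natCharFun p t ^ n * exp (-(j n * t * I))) hsn.ne'
      rw [mul_div_cancel_left₀ _ hsn.ne', mul_div_cancel_left₀ _ hsn.ne', ← h1] at h2
      simp only [g]
      rw [h2, Complex.real_smul]
      push_cast
      ring
    · have : 0 < Real.pi / h := by positivity
      nlinarith
  rw [hlim] at key
  set Λ := Real.sqrt (Real.pi / (σ ^ 2 / 2)) with hΛ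
  have hΛ0 : 0 < Λ := by positivity
  have key2 : Tendsto (fun n : ℕ => Real.sqrt n * (2 * Real.pi / h * powCoeff p n (j n))) atTop
      (nhds Λ) := by
    have h1 := (Complex.continuous_re.tendsto _).comp key
    rw [Complex.ofReal_re] at h1
    refine h1.congr' ?_
    filter_upwards [eventually_ge_atTop 1] with n hn
    simp only [Function.comp]
    rw [hval n hn, Complex.ofReal_re]
  refine ⟨h / (2 * Real.pi) * (Λ / 2), by positivity, ?_⟩
  filter_upwards [key2.eventually (lt_mem_nhds (half_lt_self hΛ0)), eventually_ge_atTop 1]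
    with n hn h1 hdvd
  have hn' : (0 : ℝ) < n := by exact_mod_cast h1
  have hsn : 0 < Real.sqrt n := Real.sqrt_pos.2 hn'
  have hjn : j n = n - 1 := Nat.mul_div_cancel' hdvd
  rw [hjn] at hn
  rw [div_le_iff₀ hsn]
  calc h / (2 * Real.pi) * (Λ / 2)
      ≤ h / (2 * Real.pi) * (Real.sqrt n * (2 * Real.pi / h * powCoeff p n (n - 1))) := by gcongr
    _ = _ := by field_simp

namespace PTree

lemma size_node (ts : List PTree) : (node ts).size = 1 + (ts.map size).sum := by
  rw [size]; simp

lemma subtrees_node (ts : List PTree) :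
    (node ts).subtrees = node ts :: (ts.map subtrees).flatten := by
  rw [subtrees]; simp

lemma one_le_size (T : PTree) : 1 ≤ T.size := by
  cases T; rw [size_node]; omega

lemma size_ofFn {c : ℕ} (x : Fin c → PTree) :
    (node (List.ofFn x)).size = 1 + ∑ i, (x i).size := by
  rw [size_node, List.map_ofFn, List.sum_ofFn]; rfl

/-- The sum of `g` over all subtrees rooted at the nodes of a tree. -/
def subtreeSum (g : PTree → ℕ) (T : PTree) : ℕ := (T.subtrees.map g).sum

lemma subtreeSum_node (g : PTree → ℕ) (ts : List PTree) :
    subtreeSum g (node ts) = g (node ts) + (ts.map (subtreeSum g)).sum := by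
  rw [subtreeSum, subtrees_node]
  simp [List.map_flatten, List.sum_flatten, Function.comp_def]
  rfl

lemma subtreeSum_ofFn (g : PTree → ℕ) {c : ℕ} (x : Fin c → PTree) :
    subtreeSum g (node (List.ofFn x)) = g (node (List.ofFn x)) + ∑ i, subtreeSum g (x i) := by
  rw [subtreeSum_node, List.map_ofFn, List.sum_ofFn]; rfl

/-- Trees as tuples of trees. -/
def sigmaEquiv : (Σ c, Fin c → PTree) ≃ PTree :=
  List.equivSigmaTuple.symm.trans
    ⟨node, fun | node ts => ts, fun _ => rfl, fun | node _ => rfl⟩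

lemma sigmaEquiv_apply {c : ℕ} (x : Fin c → PTree) : sigmaEquiv ⟨c, x⟩ = node (List.ofFn x) := rfl

lemma tsum_eq_tsum_tuple (F : PTree → ℝ≥0∞) :
    ∑' T, F T = ∑' c, ∑' x : Fin c → PTree, F (node (List.ofFn x)) := by
  rw [← sigmaEquiv.tsum_eq, ENNReal.tsum_sigma']
  rfl

@[elab_as_elim]
lemma induction_ofFn {P : PTree → Prop}
    (h : ∀ (c : ℕ) (x : Fin c → PTree), (∀ i, P (x i)) → P (node (List.ofFn x))) (T : PTree) :
    P T := by
  induction hn : T.size using Nat.strong_induction_on generalizing T with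
  | _ n ih =>
    obtain ⟨⟨c, x⟩, rfl⟩ := sigmaEquiv.surjective T
    rw [sigmaEquiv_apply] at hn ⊢
    refine h c x fun i => ih _ ?_ (x i) rfl
    rw [← hn, size_ofFn]
    have := Finset.single_le_sum (f := fun i => (x i).size) (fun _ _ => Nat.zero_le _)
      (Finset.mem_univ i)
    omega

end PTree

lemma weight_node (p : ℕ → ℝ) (ts : List PTree) :
    weight p (.node ts) = p ts.length * (ts.map (weight p)).prod := by
  rw [weight]; simp

lemma weight_ofFn (p : ℕ → ℝ) {c : ℕ} (x : Fin c → PTree) :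
    weight p (.node (List.ofFn x)) = p c * ∏ i, weight p (x i) := by
  rw [weight_node, List.map_ofFn, List.prod_ofFn, List.length_ofFn]; rfl

lemma weight_nonneg {p : ℕ → ℝ} (hp : ∀ i, 0 ≤ p i) (T : PTree) : 0 ≤ weight p T := by
  induction T using PTree.induction_ofFn with
  | h c x ih =>
    rw [weight_ofFn]
    exact mul_nonneg (hp c) (Finset.prod_nonneg fun i _ => ih i)

/-- The weight of a tree as an extended nonnegative real. -/
noncomputable def eweight (p : ℕ → ℝ) (T : PTree) : ℝ≥0∞ := ENNReal.ofReal (weight p T)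

lemma eweight_ofFn {p : ℕ → ℝ} (hp : ∀ i, 0 ≤ p i) {c : ℕ} (x : Fin c → PTree) :
    eweight p (.node (List.ofFn x)) = ENNReal.ofReal (p c) * ∏ i, eweight p (x i) := by
  rw [eweight, weight_ofFn, ENNReal.ofReal_mul (hp c),
    ENNReal.ofReal_prod_of_nonneg fun i _ => weight_nonneg hp _]
  rfl

/-- The generating series of a weight `u` with respect to a size function `s`. -/
noncomputable def sizeSeries {α : Type*} (s : α → ℕ) (u : α → ℝ≥0∞) : PowerSeries ℝ≥0∞ :=
  PowerSeries.mk fun n => ∑' a, if s a = n then u a else 0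

lemma coeff_sizeSeries {α : Type*} (s : α → ℕ) (u : α → ℝ≥0∞) (n : ℕ) :
    PowerSeries.coeff n (sizeSeries s u) = ∑' a, if s a = n then u a else 0 :=
  PowerSeries.coeff_mk _ _

lemma tsum_coeff_sizeSeries {α : Type*} (s : α → ℕ) (u : α → ℝ≥0∞) :
    ∑' n, PowerSeries.coeff n (sizeSeries s u) = ∑' a, u a := by
  simp only [coeff_sizeSeries]
  rw [ENNReal.tsum_comm]
  exact tsum_congr fun a => by rw [tsum_ite_eq']

lemma sizeSeries_mul {α β : Type*} (s : α → ℕ) (s' : β → ℕ) (u : α → ℝ≥0∞) (v : β → ℝ≥0∞) :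
    sizeSeries s u * sizeSeries s' v =
      sizeSeries (fun x : α × β => s x.1 + s' x.2) (fun x => u x.1 * v x.2) := by
  ext n
  have key : ∀ a b, (∑ i ∈ Finset.HasAntidiagonal.antidiagonal n,
      (if s a = i.1 then u a else 0) * (if s' b = i.2 then v b else 0)) =
        if s a + s' b = n then u a * v b else 0 := by
    intro a b
    split_ifs with h
    · rw [Finset.sum_eq_single (s a, s' b)]
      · simp
      · rintro ⟨i, j⟩ _ hne
        by_cases h1 : s a = i
        · have h2 : s' b ≠ j := by rintro rfl; exact hne (by rw [h1])
          simp [h2]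
        · simp [h1]
      · intro h'
        exact absurd (Finset.HasAntidiagonal.mem_antidiagonal.2 h) h'
    · refine Finset.sum_eq_zero fun x hx => ?_
      rw [Finset.HasAntidiagonal.mem_antidiagonal] at hx
      by_cases h1 : s a = x.1
      · have h2 : s' b ≠ x.2 := by intro h2; exact h (by rw [h1, h2, hx])
        simp [h2]
      · simp [h1]
  rw [PowerSeries.coeff_mul, coeff_sizeSeries,
    ENNReal.tsum_prod (f := fun a b => if s a + s' b = n then u a * v b else 0)]
  simp only [coeff_sizeSeries, ← key, ← ENNReal.tsum_mul_left, ← ENNReal.tsum_mul_right]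
  rw [← Summable.tsum_finsetSum fun _ _ => ENNReal.summable]
  rw [ENNReal.tsum_comm]
  refine tsum_congr fun b => ?_
  rw [← Summable.tsum_finsetSum fun _ _ => ENNReal.summable]

lemma sizeSeries_equiv {α β : Type*} (e : α ≃ β) (s : β → ℕ) (u : β → ℝ≥0∞) :
    sizeSeries (s ∘ e) (u ∘ e) = sizeSeries s u := by
  ext n
  rw [coeff_sizeSeries, coeff_sizeSeries, ← e.tsum_eq]
  rfl

lemma sizeSeries_pi {α : Type*} (s : α → ℕ) {c : ℕ} (u : Fin c → α → ℝ≥0∞) :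
    sizeSeries (fun x : Fin c → α => ∑ i, s (x i)) (fun x => ∏ i, u i (x i)) =
      ∏ i, sizeSeries s (u i) := by
  induction c with
  | zero =>
    ext n
    rw [coeff_sizeSeries, tsum_eq_single default fun b hb => absurd (Subsingleton.elim _ _) hb]
    simp [PowerSeries.coeff_one, eq_comm]
  | succ c ih =>
    rw [Fin.prod_univ_succ, ← ih, sizeSeries_mul, ← sizeSeries_equiv (Fin.consEquiv fun _ => α)]
    congr 1
    · funext x; simp [Fin.sum_univ_succ, Fin.consEquiv]
    · funext x; simp [Fin.prod_univ_succ, Fin.consEquiv]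

lemma coeff_succ_sizeSeries {p : ℕ → ℝ} (hp : ∀ i, 0 ≤ p i) (F : PTree → ℝ≥0∞) (n : ℕ) :
    PowerSeries.coeff (n + 1) (sizeSeries PTree.size fun T => eweight p T * F T) =
      ∑' c, ENNReal.ofReal (p c) * ∑' x : Fin c → PTree,
        if ∑ i, (x i).size = n then (∏ i, eweight p (x i)) * F (.node (List.ofFn x)) else 0 := by
  rw [coeff_sizeSeries, PTree.tsum_eq_tsum_tuple]
  refine tsum_congr fun c => ?_
  rw [← ENNReal.tsum_mul_left]
  refine tsum_congr fun x => ?_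
  rw [PTree.size_ofFn, eweight_ofFn hp, mul_ite, mul_zero, mul_assoc]
  congr 1
  rw [eq_iff_iff]; omega

lemma coeff_zero_sizeSeries (u : PTree → ℝ≥0∞) :
    PowerSeries.coeff 0 (sizeSeries PTree.size u) = 0 := by
  rw [coeff_sizeSeries, ENNReal.tsum_eq_zero]
  intro T
  rw [if_neg]
  have := T.one_le_size
  omega

/-- The generating series of Galton-Watson trees. -/
noncomputable def treeSeries (p : ℕ → ℝ) : PowerSeries ℝ≥0∞ := sizeSeries PTree.size (eweight p)

lemma coeff_succ_treeSeries {p : ℕ → ℝ} (hp : ∀ i, 0 ≤ p i) (n : ℕ) :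
    PowerSeries.coeff (n + 1) (treeSeries p) =
      ∑' c, ENNReal.ofReal (p c) * PowerSeries.coeff n (treeSeries p ^ c) := by
  have := coeff_succ_sizeSeries hp (fun _ => 1) n
  simp only [mul_one] at this
  rw [treeSeries, this]
  refine tsum_congr fun c => ?_
  have h2 := sizeSeries_pi PTree.size (fun _ : Fin c => eweight p)
  rw [Finset.prod_const, Finset.card_univ, Fintype.card_fin] at h2
  rw [← h2, coeff_sizeSeries]

lemma coeff_succ_subtreeSum {p : ℕ → ℝ} (hp : ∀ i, 0 ≤ p i) (g : PTree → ℕ) (n : ℕ) :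
    PowerSeries.coeff (n + 1)
        (sizeSeries PTree.size fun T => eweight p T * (T.subtreeSum g : ℝ≥0∞)) =
      PowerSeries.coeff (n + 1) (sizeSeries PTree.size fun T => eweight p T * (g T : ℝ≥0∞)) +
      ∑' c, ENNReal.ofReal (p c) * (c * PowerSeries.coeff n (treeSeries p ^ (c - 1) *
        sizeSeries PTree.size fun T => eweight p T * (T.subtreeSum g : ℝ≥0∞))) := by
  rw [coeff_succ_sizeSeries hp, coeff_succ_sizeSeries hp, ← ENNReal.tsum_add]
  refine tsum_congr fun c => ?_
  rw [← mul_add]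
  congr 1
  set A := sizeSeries PTree.size fun T => eweight p T * (T.subtreeSum g : ℝ≥0∞) with hA
  have key : ∀ i : Fin c, PowerSeries.coeff n (treeSeries p ^ (c - 1) * A) =
      ∑' x : Fin c → PTree, if ∑ i, (x i).size = n then
        (∏ i, eweight p (x i)) * ((x i).subtreeSum g : ℝ≥0∞) else 0 := by
    intro i
    let u : Fin c → PTree → ℝ≥0∞ := fun j T =>
      eweight p T * (if j = i then (T.subtreeSum g : ℝ≥0∞) else 1)
    have h1 : ∏ j, sizeSeries PTree.size (u j) = treeSeries p ^ (c - 1) * A := by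
      rw [← Finset.prod_erase_mul _ _ (Finset.mem_univ i)]
      congr 1
      · rw [Finset.prod_congr rfl (g := fun _ => treeSeries p), Finset.prod_const,
          Finset.card_erase_of_mem (Finset.mem_univ i), Finset.card_univ, Fintype.card_fin]
        intro j hj
        simp [u, Finset.ne_of_mem_erase hj, treeSeries]
      · simp [u, hA]
    rw [← h1, ← sizeSeries_pi, coeff_sizeSeries]
    refine tsum_congr fun x => ?_
    congr 1
    simp only [u]
    rw [Finset.prod_mul_distrib, Finset.prod_ite_eq' Finset.univ i, if_pos (Finset.mem_univ i)]
  have h3 : (c : ℝ≥0∞) * PowerSeries.coeff n (treeSeries p ^ (c - 1) * A) =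
      ∑ i : Fin c, ∑' x : Fin c → PTree, if ∑ i, (x i).size = n then
        (∏ i, eweight p (x i)) * ((x i).subtreeSum g : ℝ≥0∞) else 0 := by
    rw [← Finset.sum_congr rfl fun i _ => key i]
    simp
  rw [h3, ← Summable.tsum_finsetSum fun _ _ => ENNReal.summable, ← ENNReal.tsum_add]
  refine tsum_congr fun x => ?_
  split_ifs
  · rw [PTree.subtreeSum_ofFn]
    push_cast
    rw [mul_add, Finset.mul_sum]
  · simp

/-- The coefficient of `x ^ (m - r)` in the `m`-th power of the series with coefficients `q`. -/
noncomputable def shiftCoeff (q : ℕ → ℝ≥0∞) (r m : ℕ) : ℝ≥0∞ :=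
  if r ≤ m then PowerSeries.coeff (m - r) (PowerSeries.mk q ^ m) else 0

lemma sum_antidiagonal_eq_tsum (f : ℕ → ℕ → ℝ≥0∞) (n : ℕ) :
    ∑ x ∈ Finset.HasAntidiagonal.antidiagonal n, f x.1 x.2 =
      ∑' c, if c ≤ n then f (n - c) c else 0 := by
  rw [tsum_eq_sum (s := Finset.range (n + 1)), ← Finset.Nat.sum_antidiagonal_swap]
  · simp only [Prod.fst_swap, Prod.snd_swap]
    rw [Finset.Nat.sum_antidiagonal_eq_sum_range_succ (fun i j => f j i)]
    refine Finset.sum_congr rfl fun c hc => ?_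
    rw [if_pos (Nat.lt_succ_iff.1 (Finset.mem_range.1 hc))]
  · intro c hc
    rw [if_neg]
    simpa [Nat.lt_succ_iff] using hc

lemma shiftCoeff_succ_succ (q : ℕ → ℝ≥0∞) (r m : ℕ) :
    shiftCoeff q (r + 1) (m + 1) = ∑' c, q c * shiftCoeff q (c + r) m := by
  unfold shiftCoeff
  by_cases h : r ≤ m
  · rw [if_pos (by omega), Nat.add_sub_add_right, pow_succ, PowerSeries.coeff_mul,
      sum_antidiagonal_eq_tsum fun i j => PowerSeries.coeff i (PowerSeries.mk q ^ m) *
        PowerSeries.coeff j (PowerSeries.mk q)]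
    refine tsum_congr fun c => ?_
    by_cases hc : c + r ≤ m
    · rw [if_pos (by omega), if_pos hc, PowerSeries.coeff_mk, mul_comm, Nat.sub_sub, add_comm r]
    · rw [if_neg (by omega), if_neg hc, mul_zero]
  · rw [if_neg (by omega), eq_comm, ENNReal.tsum_eq_zero]
    intro c
    rw [if_neg (by omega), mul_zero]

open PowerSeries in
lemma shiftCoeff_zero_succ (q : ℕ → ℝ≥0∞) (m : ℕ) :
    shiftCoeff q 0 (m + 1) = ∑' c, q c * (c * shiftCoeff q (c - 1) m) := by
  have h1 := coeff_derivative (PowerSeries.mk q ^ (m + 1)) m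
  rw [derivative_pow, Nat.add_sub_cancel, mul_assoc, ← map_natCast (C (R := ℝ≥0∞)), coeff_C_mul,
    mul_comm] at h1
  have h2 : coeff m (PowerSeries.mk q ^ m * derivative ℝ≥0∞ (PowerSeries.mk q)) =
      coeff (m + 1) (PowerSeries.mk q ^ (m + 1)) := by
    push_cast at h1
    refine (ENNReal.mul_left_inj (c := (m : ℝ≥0∞) + 1) ?_ ?_).1 h1
    · positivity
    · finiteness
  unfold shiftCoeff
  rw [if_pos (Nat.zero_le _), Nat.sub_zero, ← h2, coeff_mul,
    sum_antidiagonal_eq_tsum fun i j => PowerSeries.coeff i (PowerSeries.mk q ^ m) *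
        PowerSeries.coeff j (derivative ℝ≥0∞ (PowerSeries.mk q)),
    tsum_eq_zero_add' (f := fun c => q c * _) ENNReal.summable]
  simp only [Nat.cast_zero, zero_mul, mul_zero, zero_add]
  refine tsum_congr fun c => ?_
  rw [coeff_derivative, coeff_mk, Nat.add_sub_cancel]
  split_ifs
  · push_cast; ring
  · simp

section Lagrange

variable {q : ℕ → ℝ≥0∞} {Y : PowerSeries ℝ≥0∞}

lemma pow_mul_shiftCoeff (h0 : PowerSeries.coeff 0 Y = 0)
    (hY : ∀ n, PowerSeries.coeff (n + 1) Y = ∑' c, q c * PowerSeries.coeff n (Y ^ c)) (r : ℕ) :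
    Y ^ r * PowerSeries.mk (shiftCoeff q 0) = PowerSeries.mk (shiftCoeff q r) := by
  ext m
  rw [PowerSeries.coeff_mk]
  induction m generalizing r with
  | zero =>
    cases r with
    | zero => simp
    | succ r =>
      have h1 : PowerSeries.constantCoeff Y = 0 := by simpa using h0
      simp [shiftCoeff, h1]
  | succ m ih =>
    cases r with
    | zero => simp
    | succ r =>
      rw [pow_succ', mul_assoc, PowerSeries.coeff_mul, Finset.Nat.sum_antidiagonal_succ, h0,
        zero_mul, zero_add, shiftCoeff_succ_succ]
      simp only [hY, ← ENNReal.tsum_mul_right]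
      rw [← Summable.tsum_finsetSum fun _ _ => ENNReal.summable]
      refine tsum_congr fun c => ?_
      rw [← ih, pow_add, mul_assoc (Y ^ c), PowerSeries.coeff_mul, Finset.mul_sum]
      simp only [mul_assoc]

lemma eq_mul_shiftCoeff (h0 : PowerSeries.coeff 0 Y = 0)
    (hY : ∀ n, PowerSeries.coeff (n + 1) Y = ∑' c, q c * PowerSeries.coeff n (Y ^ c))
    {A E : PowerSeries ℝ≥0∞} (hA0 : PowerSeries.coeff 0 A = 0) (hE0 : PowerSeries.coeff 0 E = 0)
    (hA : ∀ n, PowerSeries.coeff (n + 1) A = PowerSeries.coeff (n + 1) E +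
      ∑' c, q c * (c * PowerSeries.coeff n (Y ^ (c - 1) * A))) :
    A = E * PowerSeries.mk (shiftCoeff q 0) := by
  ext n
  induction n using Nat.strong_induction_on with
  | _ n ih =>
    cases n with
    | zero => simp at hA0 hE0 ⊢; simp [hA0, hE0]
    | succ n =>
      have h1 : ∀ r, PowerSeries.coeff n (Y ^ r * A) =
          PowerSeries.coeff n (E * PowerSeries.mk (shiftCoeff q r)) := by
        intro r
        rw [← pow_mul_shiftCoeff h0 hY, mul_left_comm, PowerSeries.coeff_mul,
          PowerSeries.coeff_mul _ _ (E * _)]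
        refine Finset.sum_congr rfl fun x hx => ?_
        rw [ih]
        have := Finset.HasAntidiagonal.mem_antidiagonal.1 hx
        omega
      rw [hA, PowerSeries.coeff_mul, Finset.Nat.sum_antidiagonal_succ']
      congr 1
      · simp [shiftCoeff]
      · simp only [h1, PowerSeries.coeff_mul, PowerSeries.coeff_mk, shiftCoeff_zero_succ,
          Finset.mul_sum, ← ENNReal.tsum_mul_left]
        rw [← Summable.tsum_finsetSum fun _ _ => ENNReal.summable]
        refine tsum_congr fun c => Finset.sum_congr rfl fun x _ => ?_
        ring

end Lagrange

lemma coeff_subtreeSum {p : ℕ → ℝ} (hp : ∀ i, 0 ≤ p i) (g : PTree → ℕ) (n : ℕ) :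
    PowerSeries.coeff n (sizeSeries PTree.size fun T => eweight p T * (T.subtreeSum g : ℝ≥0∞)) =
      ∑ x ∈ Finset.HasAntidiagonal.antidiagonal n,
        PowerSeries.coeff x.1 (sizeSeries PTree.size fun T => eweight p T * (g T : ℝ≥0∞)) *
          shiftCoeff (fun c => ENNReal.ofReal (p c)) 0 x.2 := by
  rw [eq_mul_shiftCoeff (coeff_zero_sizeSeries _) (coeff_succ_treeSeries hp)
    (coeff_zero_sizeSeries _) (coeff_zero_sizeSeries _) (coeff_succ_subtreeSum hp g),
    PowerSeries.coeff_mul]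
  simp only [PowerSeries.coeff_mk]

lemma PTree.subtreeSum_one (T : PTree) : T.subtreeSum (fun _ => 1) = T.size := by
  induction T using PTree.induction_ofFn with
  | h c x ih => rw [subtreeSum_ofFn, size_ofFn, Finset.sum_congr rfl fun i _ => ih i]

lemma natCast_mul_coeff_treeSeries {p : ℕ → ℝ} (hp : ∀ i, 0 ≤ p i) (n : ℕ) :
    n * PowerSeries.coeff n (treeSeries p) = shiftCoeff (fun c => ENNReal.ofReal (p c)) 1 n := by
  have h1 := coeff_subtreeSum hp (fun _ => 1) n
  have h2 := pow_mul_shiftCoeff (coeff_zero_sizeSeries _) (coeff_succ_treeSeries hp) 1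
  rw [pow_one] at h2
  have h3 := congrArg (PowerSeries.coeff n) h2
  rw [PowerSeries.coeff_mul, PowerSeries.coeff_mk] at h3
  simp only [PowerSeries.coeff_mk] at h3
  simp only [Nat.cast_one, mul_one] at h1
  rw [h3] at h1
  rw [← h1, treeSeries, coeff_sizeSeries, coeff_sizeSeries, ← ENNReal.tsum_mul_left]
  refine tsum_congr fun T => ?_
  rw [PTree.subtreeSum_one]
  split_ifs with h
  · rw [h, mul_comm]
  · simp

lemma coeff_pow_ofReal {p : ℕ → ℝ} (hp : ∀ i, 0 ≤ p i) (m j : ℕ) :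
    PowerSeries.coeff j (PowerSeries.mk (fun c => ENNReal.ofReal (p c)) ^ m) =
      ENNReal.ofReal (powCoeff p m j) := by
  induction m generalizing j with
  | zero => rw [powCoeff_zero, pow_zero, PowerSeries.coeff_one]; split_ifs <;> simp
  | succ m ih =>
    rw [powCoeff_succ, pow_succ, PowerSeries.coeff_mul,
      ENNReal.ofReal_sum_of_nonneg fun x _ => mul_nonneg (powCoeff_nonneg hp _ _) (hp _)]
    refine Finset.sum_congr rfl fun x _ => ?_
    rw [ih, PowerSeries.coeff_mk, ENNReal.ofReal_mul (powCoeff_nonneg hp _ _)]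

lemma shiftCoeff_zero_ofReal {p : ℕ → ℝ} (hp : ∀ i, 0 ≤ p i) (m : ℕ) :
    shiftCoeff (fun c => ENNReal.ofReal (p c)) 0 m = ENNReal.ofReal (powCoeff p m m) := by
  rw [shiftCoeff, if_pos (Nat.zero_le _), coeff_pow_ofReal hp, Nat.sub_zero]

lemma coeff_treeSeries {p : ℕ → ℝ} (hp : ∀ i, 0 ≤ p i) {n : ℕ} (hn : 1 ≤ n) :
    PowerSeries.coeff n (treeSeries p) = ENNReal.ofReal (powCoeff p n (n - 1) / n) := by
  have h := natCast_mul_coeff_treeSeries hp n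
  rw [shiftCoeff, if_pos hn, coeff_pow_ofReal hp] at h
  rw [ENNReal.ofReal_div_of_pos (by positivity), ← h, ENNReal.ofReal_natCast,
    mul_comm, ENNReal.mul_div_cancel_right (by positivity) (by finiteness)]

namespace PTree

/-- The total size of the subtrees rooted at the children of the root of rank larger than `k`. -/
def lightMass (k : ℕ) : PTree → ℕ
  | node ts => ∑ i ∈ Finset.range ts.length,
      if k < rankIn (ts.map size) i then (ts.map size).getD i 0 else 0

lemma lightMass_ofFn (k : ℕ) {c : ℕ} (x : Fin c → PTree) :
    lightMass k (node (List.ofFn x)) =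
      ∑ i : Fin c, if k < rankIn (List.ofFn fun j => (x j).size) i then (x i).size else 0 := by
  rw [lightMass, List.length_ofFn, Finset.sum_range, List.map_ofFn]
  refine Finset.sum_congr rfl fun i _ => ?_
  simp [Function.comp_def]

lemma heavySizeAux_ofFn (k : ℕ) (sizes : List ℕ) {c : ℕ} (x : Fin c → PTree) (i : ℕ) :
    heavySizeAux k sizes i (List.ofFn x) =
      ∑ j : Fin c, if rankIn sizes (i + j) ≤ k then heavySize k (x j) else 0 := by
  induction c generalizing i with
  | zero => simp [heavySizeAux]
  | succ c ih =>
    rw [List.ofFn_succ, heavySizeAux, ih, Fin.sum_univ_succ]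
    simp [add_assoc, add_comm 1]

lemma heavySize_ofFn (k : ℕ) {c : ℕ} (x : Fin c → PTree) :
    heavySize k (node (List.ofFn x)) =
      1 + ∑ i : Fin c, if rankIn (List.ofFn fun j => (x j).size) i ≤ k then heavySize k (x i) else 0 := by
  rw [heavySize, heavySizeAux_ofFn, List.map_ofFn]
  simp [Function.comp_def]

lemma lightMass_le_size (k : ℕ) (T : PTree) : lightMass k T ≤ T.size := by
  cases T using induction_ofFn with
  | h c x _ =>
    rw [lightMass_ofFn, size_ofFn]
    refine le_add_left (Finset.sum_le_sum fun i _ => ?_)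
    split_ifs <;> omega

lemma size_le_heavySize_add (k K : ℕ) (T : PTree) :
    T.size ≤ (1 + K) * heavySize k T +
      T.subtreeSum fun S => if K < lightMass k S then lightMass k S else 0 := by
  induction T using induction_ofFn with
  | h c x ih =>
    rw [size_ofFn, heavySize_ofFn, subtreeSum_ofFn]
    set r := rankIn (List.ofFn fun j => (x j).size) with hr
    set g : PTree → ℕ := fun S => if K < lightMass k S then lightMass k S else 0
    have h1 : lightMass k (node (List.ofFn x)) ≤ K + g (node (List.ofFn x)) := by
      simp only [g]; split_ifs <;> omega
    rw [lightMass_ofFn, ← hr] at h1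
    have h2 : ∑ i, (x i).size ≤ (1 + K) * (∑ i : Fin c, if r i ≤ k then heavySize k (x i) else 0) +
        ∑ i, subtreeSum g (x i) + ∑ i : Fin c, if k < r i then (x i).size else 0 := by
      rw [Finset.mul_sum, ← Finset.sum_add_distrib, ← Finset.sum_add_distrib]
      refine Finset.sum_le_sum fun i _ => ?_
      have := ih i
      by_cases h : r i ≤ k
      · rw [if_pos h, if_neg (by omega)]; omega
      · rw [if_neg h, if_pos (by omega)]; omega
    have h3 : (if K < lightMass k (node (List.ofFn x)) then lightMass k (node (List.ofFn x)) else 0) =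
      g (node (List.ofFn x)) := rfl
    rw [mul_add, h3]
    omega

end PTree

lemma exists_of_two_lt_rankIn {c : ℕ} (s : Fin c → ℕ) (i : Fin c)
    (h : 2 < rankIn (List.ofFn s) i) :
    ∃ j l, j ≠ i ∧ l ≠ i ∧ j ≠ l ∧ s i ≤ s j ∧ ∑ m, s m ≤ c * s l := by
  have hcard : 1 < (Finset.univ.filter fun j : Fin c => s i < s j ∨ (s j = s i ∧ j < i)).card := by
    rw [rankIn, List.length_ofFn] at h
    have h1 : ((List.range c).filter (fun j => decide ((List.ofFn s).getD (i : ℕ) 0 < (List.ofFn s).getD j 0 ∨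
        ((List.ofFn s).getD j 0 = (List.ofFn s).getD (i : ℕ) 0 ∧ j < i)))).length =
        (Finset.univ.filter fun j : Fin c => s i < s j ∨ (s j = s i ∧ j < i)).card := by
      rw [← List.toFinset_card_of_nodup (List.nodup_range.filter _)]
      symm
      refine Finset.card_bij (fun j _ => (j : ℕ)) ?_ (fun _ _ _ _ => Fin.ext) ?_
      · intro j hj
        simpa using hj
      · intro b hb
        simp only [List.mem_toFinset, List.mem_filter, List.mem_range] at hb
        exact ⟨⟨b, hb.1⟩, by
        simp only [Finset.mem_filter, Finset.mem_univ, true_and]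
        have h3 := hb.2
        simp [hb.1] at h3
        exact h3, rfl⟩
    omega
  obtain ⟨j₁, hj₁, j₂, hj₂, hne⟩ := Finset.one_lt_card.1 hcard
  simp only [Finset.mem_filter, Finset.mem_univ, true_and] at hj₁ hj₂
  have hi₁ : j₁ ≠ i := by rintro rfl; simp at hj₁
  have hi₂ : j₂ ≠ i := by rintro rfl; simp at hj₂
  obtain ⟨m, -, hm⟩ := Finset.exists_max_image Finset.univ s ⟨i, Finset.mem_univ i⟩
  have hle : ∀ l, s m ≤ s l → ∑ m, s m ≤ c * s l := by
    intro l hl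
    have := Finset.sum_le_card_nsmul Finset.univ s (s l) fun j hj => (hm j hj).trans hl
    simpa using this
  rcases eq_or_ne m i with rfl | hmi
  · exact ⟨j₁, j₂, hi₁, hi₂, hne, by omega, hle _ (by omega)⟩
  · by_cases h1 : j₁ = m
    · exact ⟨j₂, m, hi₂, hmi, by rw [← h1]; exact hne.symm, by omega, hle _ le_rfl⟩
    · exact ⟨j₁, m, hi₁, hmi, h1, by omega, hle _ le_rfl⟩

lemma sizeSeries_id_coeff (A : PowerSeries ℝ≥0∞) :
    sizeSeries (id : ℕ → ℕ) (fun n => PowerSeries.coeff n A) = A := by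
  ext n
  rw [coeff_sizeSeries]
  exact tsum_ite_eq n _

lemma tsum_coeff_mul (A B : PowerSeries ℝ≥0∞) :
    ∑' n, PowerSeries.coeff n (A * B) =
      (∑' n, PowerSeries.coeff n A) * ∑' n, PowerSeries.coeff n B := by
  conv_lhs => rw [← sizeSeries_id_coeff A, ← sizeSeries_id_coeff B, sizeSeries_mul]
  rw [tsum_coeff_sizeSeries,
    ENNReal.tsum_prod (f := fun a b => PowerSeries.coeff a A * PowerSeries.coeff b B)]
  simp only [ENNReal.tsum_mul_left, ENNReal.tsum_mul_right]

lemma tsum_coeff_prod {ι : Type*} (s : Finset ι) (A : ι → PowerSeries ℝ≥0∞) :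
    ∑' n, PowerSeries.coeff n (∏ i ∈ s, A i) = ∏ i ∈ s, ∑' n, PowerSeries.coeff n (A i) := by
  classical
  induction s using Finset.induction_on with
  | empty =>
    rw [Finset.prod_empty, Finset.prod_empty]
    simp only [PowerSeries.coeff_one]
    exact tsum_ite_eq 0 _
  | insert a s ha ih => rw [Finset.prod_insert ha, Finset.prod_insert ha, tsum_coeff_mul, ih]

lemma coeff_mul_le (A E : PowerSeries ℝ≥0∞) {B : ℝ≥0∞} (hE : ∀ m, PowerSeries.coeff m E ≤ B)
    (n : ℕ) : PowerSeries.coeff n (A * E) ≤ (∑' m, PowerSeries.coeff m A) * B := by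
  rw [PowerSeries.coeff_mul, Finset.Nat.sum_antidiagonal_eq_sum_range_succ_mk]
  calc _ ≤ ∑ k ∈ Finset.range n.succ, PowerSeries.coeff k A * B :=
        Finset.sum_le_sum fun k _ => mul_le_mul_right (hE _) _
    _ = (∑ k ∈ Finset.range n.succ, PowerSeries.coeff k A) * B := by rw [Finset.sum_mul]
    _ ≤ _ := mul_le_mul_left (ENNReal.sum_le_tsum _) _

lemma natCast_le_rpow_mul {a b n : ℕ} (hab : a ≤ b) (han : a ≤ n) :
    (a : ℝ) ≤ (n : ℝ) ^ (1 / 4 : ℝ) * ((a : ℝ) ^ (3 / 8 : ℝ) * (b : ℝ) ^ (3 / 8 : ℝ)) := by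
  rcases Nat.eq_zero_or_pos a with rfl | ha
  · simp
  · have ha' : (0 : ℝ) < a := by exact_mod_cast ha
    calc (a : ℝ) = (a : ℝ) ^ (1 / 4 : ℝ) * ((a : ℝ) ^ (3 / 8 : ℝ) * (a : ℝ) ^ (3 / 8 : ℝ)) := by
          rw [← Real.rpow_add ha', ← Real.rpow_add ha']; norm_num
      _ ≤ _ := by gcongr

/-- The contribution of three given children to the light mass of a tree. -/
noncomputable def tripleFactor (n c : ℕ) (i j l m : Fin c) (T : PTree) : ℝ≥0∞ :=
  (if m = l then (if n ≤ c * T.size then 1 else 0) else 1) *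
    ((if m = i then ENNReal.ofReal ((T.size : ℝ) ^ (3 / 8 : ℝ)) else 1) *
      (if m = j then ENNReal.ofReal ((T.size : ℝ) ^ (3 / 8 : ℝ)) else 1))

lemma lightMass_le_sum_tripleFactor {n c : ℕ} (x : Fin c → PTree) (hx : ∑ i, (x i).size = n) :
    (PTree.lightMass 2 (.node (List.ofFn x)) : ℝ≥0∞) ≤
      ∑ i, ∑ j, ∑ l, if i ≠ j ∧ i ≠ l ∧ j ≠ l then
        ENNReal.ofReal ((n : ℝ) ^ (1 / 4 : ℝ)) * ∏ m, tripleFactor n c i j l m (x m) else 0 := by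
  rw [PTree.lightMass_ofFn]
  push_cast
  refine Finset.sum_le_sum fun i _ => ?_
  split_ifs with h
  · obtain ⟨j, l, hj, hl, hjl, hij, hle⟩ := exists_of_two_lt_rankIn (fun j => (x j).size) i h
    rw [hx] at hle
    refine le_trans ?_ (Finset.single_le_sum (fun _ _ => zero_le) (Finset.mem_univ j))
    refine le_trans ?_ (Finset.single_le_sum (fun _ _ => zero_le) (Finset.mem_univ l))
    rw [if_pos ⟨hj.symm, hl.symm, hjl⟩]
    simp only [tripleFactor]
    rw [Finset.prod_mul_distrib, Finset.prod_mul_distrib, Finset.prod_ite_eq' _ l,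
      Finset.prod_ite_eq' _ i, Finset.prod_ite_eq' _ j]
    simp only [Finset.mem_univ, if_true, hle, one_mul]
    rw [← ENNReal.ofReal_mul (by positivity), ← ENNReal.ofReal_mul (by positivity),
      ← ENNReal.ofReal_natCast]
    refine ENNReal.ofReal_le_ofReal (natCast_le_rpow_mul hij ?_)
    rw [← hx]
    exact Finset.single_le_sum (f := fun i => (x i).size) (fun _ _ => Nat.zero_le _)
      (Finset.mem_univ i)
  · simp

section

variable {p : ℕ → ℝ} {C : ℝ}

lemma tsum_eweight_mul_rpow_ne_top
    (hC : ∀ n, 1 ≤ n → PowerSeries.coeff n (treeSeries p) ≤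
      ENNReal.ofReal (C * (n : ℝ) ^ (-(3 / 2) : ℝ))) :
    ∑' T, eweight p T * ENNReal.ofReal ((T.size : ℝ) ^ (3 / 8 : ℝ)) ≠ ∞ := by
  rw [← tsum_coeff_sizeSeries PTree.size]
  have hs : Summable fun n : ℕ => |C| * (n : ℝ) ^ (-(9 / 8) : ℝ) :=
    (Real.summable_nat_rpow.2 (by norm_num)).mul_left _
  refine ne_top_of_le_ne_top hs.tsum_ofReal_ne_top (ENNReal.tsum_le_tsum fun n => ?_)
  rcases Nat.eq_zero_or_pos n with rfl | hn
  · rw [coeff_zero_sizeSeries]; exact zero_le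
  · have hn' : (0 : ℝ) < n := by exact_mod_cast hn
    calc PowerSeries.coeff n (sizeSeries PTree.size fun T =>
          eweight p T * ENNReal.ofReal ((T.size : ℝ) ^ (3 / 8 : ℝ)))
        = PowerSeries.coeff n (treeSeries p) * ENNReal.ofReal ((n : ℝ) ^ (3 / 8 : ℝ)) := by
          rw [treeSeries, coeff_sizeSeries, coeff_sizeSeries, ← ENNReal.tsum_mul_right]
          refine tsum_congr fun T => ?_
          split_ifs with h
          · rw [h]
          · simp
      _ ≤ ENNReal.ofReal (|C| * (n : ℝ) ^ (-(3 / 2) : ℝ)) *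
            ENNReal.ofReal ((n : ℝ) ^ (3 / 8 : ℝ)) := by
          gcongr
          refine (hC n hn).trans (ENNReal.ofReal_le_ofReal ?_)
          gcongr
          exact le_abs_self C
      _ = _ := by
          rw [← ENNReal.ofReal_mul (by positivity), mul_assoc, ← Real.rpow_add hn']
          norm_num

lemma coeff_prod_tripleFactor_le (hC0 : 0 ≤ C)
    (hC : ∀ n, 1 ≤ n → PowerSeries.coeff n (treeSeries p) ≤
      ENNReal.ofReal (C * (n : ℝ) ^ (-(3 / 2) : ℝ)))
    (h1 : ∑' T, eweight p T ≤ 1) {n c : ℕ} (hn : 1 ≤ n) {i j l : Fin c}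
    (hij : i ≠ j) (hil : i ≠ l) (hjl : j ≠ l) :
    PowerSeries.coeff n (∏ m, sizeSeries PTree.size fun T =>
      eweight p T * tripleFactor n c i j l m T) ≤
      (∑' T, eweight p T * ENNReal.ofReal ((T.size : ℝ) ^ (3 / 8 : ℝ))) ^ 2 *
        ENNReal.ofReal (C * ((n : ℝ) / c) ^ (-(3 / 2) : ℝ)) := by
  set D := ∑' T, eweight p T * ENNReal.ofReal ((T.size : ℝ) ^ (3 / 8 : ℝ)) with hD
  have hc : 0 < c := Fin.pos i
  rw [← Finset.prod_erase_mul _ _ (Finset.mem_univ l)]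
  refine (coeff_mul_le _ _ (B := ENNReal.ofReal (C * ((n : ℝ) / c) ^ (-(3 / 2) : ℝ)))
    (fun m => ?_) n).trans (mul_le_mul_left ?_ _)
  · have h2 : ∀ T, eweight p T * tripleFactor n c i j l l T =
        if n ≤ c * T.size then eweight p T else 0 := by
      intro T
      simp [tripleFactor, hil.symm, hjl.symm]
    simp only [h2]
    by_cases hm : n ≤ c * m
    · have hm0 : 1 ≤ m := by
        rcases Nat.eq_zero_or_pos m with rfl | h
        · simp at hm; omega
        · exact h
      calc _ ≤ PowerSeries.coeff m (treeSeries p) := by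
            rw [treeSeries, coeff_sizeSeries, coeff_sizeSeries]
            refine ENNReal.tsum_le_tsum fun T => ?_
            split_ifs <;> simp
        _ ≤ _ := hC m hm0
        _ ≤ _ := by
            refine ENNReal.ofReal_le_ofReal (mul_le_mul_of_nonneg_left ?_ hC0)
            refine Real.rpow_le_rpow_of_nonpos (by positivity) ?_ (by norm_num)
            rw [div_le_iff₀ (by positivity)]
            exact_mod_cast (mul_comm c m ▸ hm)
    · rw [coeff_sizeSeries, ENNReal.tsum_eq_zero.2]
      · exact zero_le
      · intro T
        split_ifs with h3 h4
        · exact absurd (h3 ▸ h4) hm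
        · rfl
        · rfl
  · rw [tsum_coeff_prod]
    calc _ ≤ ∏ m ∈ Finset.univ.erase l, ((if m = i then D else 1) * (if m = j then D else 1)) := by
          refine Finset.prod_le_prod' fun m hm => ?_
          have hml := Finset.ne_of_mem_erase hm
          rw [tsum_coeff_sizeSeries]
          simp only [tripleFactor, hml, if_false, one_mul]
          by_cases hmi : m = i
          · simp [hmi, hij, hD]
          · by_cases hmj : m = j
            · simp [hmj, hij.symm, hD]
            · simpa [hmi, hmj] using h1
      _ = D ^ 2 := by
          rw [Finset.prod_mul_distrib, Finset.prod_ite_eq' _ i, Finset.prod_ite_eq' _ j,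
            if_pos (by simp [hil]), if_pos (by simp [hjl]), sq]

lemma coeff_lightMass_le (hp : ∀ i, 0 ≤ p i) (hC0 : 0 ≤ C)
    (hC : ∀ n, 1 ≤ n → PowerSeries.coeff n (treeSeries p) ≤
      ENNReal.ofReal (C * (n : ℝ) ^ (-(3 / 2) : ℝ)))
    (h1 : ∑' T, eweight p T ≤ 1) (hmom : MomentFinite p 5) :
    ∃ C', 0 ≤ C' ∧ ∀ k, 2 ≤ k → PowerSeries.coeff k (sizeSeries PTree.size fun T =>
      eweight p T * (PTree.lightMass 2 T : ℝ≥0∞)) ≤ ENNReal.ofReal (C' * (k : ℝ) ^ (-(5 / 4) : ℝ)) := by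
  set D := ∑' T, eweight p T * ENNReal.ofReal ((T.size : ℝ) ^ (3 / 8 : ℝ)) with hD
  have hDtop : D ≠ ∞ := tsum_eweight_mul_rpow_ne_top hC
  set S := ∑' c : ℕ, (c : ℝ) ^ (5 : ℝ) * p c with hS
  have hS0 : 0 ≤ S := tsum_nonneg fun c => mul_nonneg (by positivity) (hp c)
  have key : ∀ n : ℕ, 1 ≤ n → PowerSeries.coeff (n + 1) (sizeSeries PTree.size fun T =>
      eweight p T * (PTree.lightMass 2 T : ℝ≥0∞)) ≤
        ENNReal.ofReal (C * D.toReal ^ 2 * S * (n : ℝ) ^ (-(5 / 4) : ℝ)) := by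
    intro n hn
    have hn' : (0 : ℝ) < n := by exact_mod_cast hn
    rw [coeff_succ_sizeSeries hp]
    have h2 : ∀ c : ℕ, (∑' x : Fin c → PTree, if ∑ i, (x i).size = n then
        (∏ i, eweight p (x i)) * (PTree.lightMass 2 (.node (List.ofFn x)) : ℝ≥0∞) else 0) ≤
        ENNReal.ofReal ((n : ℝ) ^ (-(5 / 4) : ℝ) * (C * D.toReal ^ 2) * (c : ℝ) ^ (5 : ℝ)) := by
      intro c
      calc _ ≤ ∑' x : Fin c → PTree, ∑ i, ∑ j, ∑ l, (if i ≠ j ∧ i ≠ l ∧ j ≠ l then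
            ENNReal.ofReal ((n : ℝ) ^ (1 / 4 : ℝ)) * if ∑ i, (x i).size = n then
              ∏ m, (eweight p (x m) * tripleFactor n c i j l m (x m)) else 0 else 0) := by
            refine ENNReal.tsum_le_tsum fun x => ?_
            split_ifs with hx
            · refine (mul_le_mul_right (lightMass_le_sum_tripleFactor x hx) _).trans (le_of_eq ?_)
              simp only [Finset.mul_sum, Finset.prod_mul_distrib, mul_ite, mul_zero]
              refine Finset.sum_congr rfl fun i _ => Finset.sum_congr rfl fun j _ =>
                Finset.sum_congr rfl fun l _ => ?_
              split_ifs
              · ring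
              · rfl
            · exact zero_le
        _ = ∑ i, ∑ j, ∑ l, (if i ≠ j ∧ i ≠ l ∧ j ≠ l then
            ENNReal.ofReal ((n : ℝ) ^ (1 / 4 : ℝ)) *
              PowerSeries.coeff n (∏ m, sizeSeries PTree.size fun T =>
                eweight p T * tripleFactor n c i j l m T) else 0) := by
            rw [Summable.tsum_finsetSum fun _ _ => ENNReal.summable]
            refine Finset.sum_congr rfl fun i _ => ?_
            rw [Summable.tsum_finsetSum fun _ _ => ENNReal.summable]
            refine Finset.sum_congr rfl fun j _ => ?_
            rw [Summable.tsum_finsetSum fun _ _ => ENNReal.summable]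
            refine Finset.sum_congr rfl fun l _ => ?_
            split_ifs
            · rw [ENNReal.tsum_mul_left, ← sizeSeries_pi, coeff_sizeSeries]
            · simp
        _ ≤ ∑ i : Fin c, ∑ j : Fin c, ∑ l : Fin c, ENNReal.ofReal ((n : ℝ) ^ (1 / 4 : ℝ)) *
              (D ^ 2 * ENNReal.ofReal (C * ((n : ℝ) / c) ^ (-(3 / 2) : ℝ))) := by
            refine Finset.sum_le_sum fun i _ => Finset.sum_le_sum fun j _ =>
              Finset.sum_le_sum fun l _ => ?_
            split_ifs with h
            · exact mul_le_mul_right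
                (coeff_prod_tripleFactor_le hC0 hC h1 hn h.1 h.2.1 h.2.2) _
            · exact zero_le
        _ = ENNReal.ofReal ((c : ℝ) ^ 3 * ((n : ℝ) ^ (1 / 4 : ℝ) *
              (D.toReal ^ 2 * (C * ((n : ℝ) / c) ^ (-(3 / 2) : ℝ))))) := by
            rw [ENNReal.ofReal_mul (p := (c : ℝ) ^ 3) (by positivity),
              ENNReal.ofReal_mul (p := (n : ℝ) ^ (1 / 4 : ℝ)) (by positivity),
              ENNReal.ofReal_mul (p := D.toReal ^ 2) (by positivity), ENNReal.ofReal_pow (by positivity),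
              ENNReal.ofReal_pow (by positivity), ENNReal.ofReal_toReal hDtop]
            simp
            ring
        _ ≤ _ := by
            refine ENNReal.ofReal_le_ofReal ?_
            rcases Nat.eq_zero_or_pos c with rfl | hc
            · simp
            · have hc' : (0 : ℝ) < c := by exact_mod_cast hc
              have hc1 : (1 : ℝ) ≤ c := by exact_mod_cast hc
              have h3 : (c : ℝ) ^ 3 * (c : ℝ) ^ (3 / 2 : ℝ) ≤ (c : ℝ) ^ (5 : ℝ) := by
                rw [← Real.rpow_natCast, ← Real.rpow_add hc']
                exact Real.rpow_le_rpow_of_exponent_le hc1 (by norm_num)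
              have h4 : (n : ℝ) ^ (1 / 4 : ℝ) * (n : ℝ) ^ (-(3 / 2) : ℝ) =
                  (n : ℝ) ^ (-(5 / 4) : ℝ) := by
                rw [← Real.rpow_add hn']; norm_num
              rw [Real.div_rpow hn'.le hc'.le, Real.rpow_neg hc'.le, div_inv_eq_mul, ← h4]
              calc _ = (n : ℝ) ^ (1 / 4 : ℝ) * (n : ℝ) ^ (-(3 / 2) : ℝ) * (C * D.toReal ^ 2) *
                    ((c : ℝ) ^ 3 * (c : ℝ) ^ (3 / 2 : ℝ)) := by ring
                _ ≤ _ := by gcongr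
    calc _ ≤ ∑' c, ENNReal.ofReal (p c) *
          ENNReal.ofReal ((n : ℝ) ^ (-(5 / 4) : ℝ) * (C * D.toReal ^ 2) * (c : ℝ) ^ (5 : ℝ)) :=
          ENNReal.tsum_le_tsum fun c => mul_le_mul_right (h2 c) _
      _ = ∑' c : ℕ, ENNReal.ofReal ((n : ℝ) ^ (-(5 / 4) : ℝ) * (C * D.toReal ^ 2)) *
          ENNReal.ofReal ((c : ℝ) ^ (5 : ℝ) * p c) := by
          refine tsum_congr fun c => ?_
          rw [← ENNReal.ofReal_mul (hp c), ← ENNReal.ofReal_mul (by positivity)]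
          congr 1; ring
      _ = _ := by
          rw [ENNReal.tsum_mul_left, ← ENNReal.ofReal_tsum_of_nonneg
            (fun c => mul_nonneg (by positivity) (hp c)) hmom, ← ENNReal.ofReal_mul (by positivity)]
          congr 1; ring
  refine ⟨C * D.toReal ^ 2 * S * 2 ^ (5 / 4 : ℝ), by positivity, fun k hk => ?_⟩
  obtain ⟨n, rfl⟩ : ∃ n, k = n + 1 := ⟨k - 1, by omega⟩
  have hn : 1 ≤ n := by omega
  have hn' : (1 : ℝ) ≤ n := by exact_mod_cast hn
  refine (key n hn).trans (ENNReal.ofReal_le_ofReal ?_)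
  rw [mul_assoc _ ((2 : ℝ) ^ (5 / 4 : ℝ))]
  refine mul_le_mul_of_nonneg_left ?_ (by positivity)
  have h5 : (2 : ℝ) ^ (5 / 4 : ℝ) = (1 / 2 : ℝ) ^ (-(5 / 4) : ℝ) := by
    rw [one_div, Real.inv_rpow (by norm_num), Real.rpow_neg (by norm_num), inv_inv]
  rw [h5, ← Real.mul_rpow (by norm_num) (by positivity)]
  refine Real.rpow_le_rpow_of_nonpos (by positivity) ?_ (by norm_num)
  push_cast
  linarith

end

lemma tsum_pi_prod {α : Type*} (c : ℕ) (u : α → ℝ≥0∞) :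
    ∑' x : Fin c → α, ∏ i, u (x i) = (∑' a, u a) ^ c := by
  have h := sizeSeries_pi (fun _ : α => 0) (fun _ : Fin c => u)
  rw [Finset.prod_const, Finset.card_univ, Fintype.card_fin] at h
  have h0 := congrArg (PowerSeries.constantCoeff) h
  rw [map_pow, ← PowerSeries.coeff_zero_eq_constantCoeff_apply,
    ← PowerSeries.coeff_zero_eq_constantCoeff_apply, coeff_sizeSeries, coeff_sizeSeries] at h0
  simpa using h0

lemma PTree.subtreeSum_le_mul_size {f : PTree → ℕ} {M : ℕ} (hf : ∀ T, f T ≤ M) (T : PTree) :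
    T.subtreeSum f ≤ M * T.size := by
  induction T using PTree.induction_ofFn with
  | h c x ih =>
    rw [subtreeSum_ofFn, size_ofFn, mul_add, mul_one, Finset.mul_sum]
    exact add_le_add (hf _) (Finset.sum_le_sum fun i _ => ih i)

section

variable {p : ℕ → ℝ}

lemma tsum_exp_subtreeSum_le (hp : ∀ i, 0 ≤ p i) (hs : ∑' c, ENNReal.ofReal (p c) ≤ 1)
    {L r K : ℝ≥0∞} {M : ℕ} {f : PTree → ℕ} (hf : ∀ T, f T ≠ 0 → T.size ≤ M) (hfM : ∀ T, f T ≤ M)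
    (hr : r ≤ 1) (hL : 1 ≤ L) (hK : ∀ m ≤ M, L ^ m ≤ 1 + K * m)
    (hδ : r + K * L ^ (M * M) * ∑' T, eweight p T * (f T : ℝ≥0∞) ≤ 1) (N : ℕ) :
    ∑' T, (if T.size ≤ N then eweight p T * (r ^ T.size * L ^ T.subtreeSum f) else 0) ≤ 1 := by
  induction N with
  | zero =>
    rw [ENNReal.tsum_eq_zero.2]
    · exact zero_le
    · intro T
      rw [if_neg]
      have := T.one_le_size
      omega
  | succ N ih =>
    set v : PTree → ℝ≥0∞ := fun T =>
      if T.size ≤ N then eweight p T * (r ^ T.size * L ^ T.subtreeSum f) else 0 with hv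
    have key : ∀ (c : ℕ) (x : Fin c → PTree),
        (if (PTree.node (List.ofFn x)).size ≤ N + 1 then eweight p (.node (List.ofFn x)) *
          (r ^ (PTree.node (List.ofFn x)).size *
            L ^ (PTree.node (List.ofFn x)).subtreeSum f) else 0) ≤
        r * (ENNReal.ofReal (p c) * ∏ i, v (x i)) +
          K * L ^ (M * M) * (eweight p (.node (List.ofFn x)) * (f (.node (List.ofFn x)) : ℝ≥0∞)) := by
      intro c x
      split_ifs with h
      · have hprod : ∏ i, v (x i) = (∏ i, eweight p (x i)) *
            (r ^ ∑ i, (x i).size) * L ^ ∑ i, (x i).subtreeSum f := by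
          rw [← Finset.prod_pow_eq_pow_sum, ← Finset.prod_pow_eq_pow_sum,
            ← Finset.prod_mul_distrib, ← Finset.prod_mul_distrib]
          refine Finset.prod_congr rfl fun i _ => ?_
          have := Finset.single_le_sum (f := fun i => (x i).size) (fun _ _ => Nat.zero_le _)
            (Finset.mem_univ i)
          rw [PTree.size_ofFn] at h
          simp only [hv]
          rw [if_pos (by omega), mul_assoc]
        set F := ∑ i, (x i).subtreeSum f with hF
        set s := ∑ i, (x i).size with hs'
        set T := PTree.node (List.ofFn x) with hT
        have hsize : T.size = 1 + s := PTree.size_ofFn x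
        have hsub : T.subtreeSum f = f T + F := PTree.subtreeSum_ofFn f x
        have hw : ENNReal.ofReal (p c) * ∏ i, v (x i) = eweight p T * (r ^ s * L ^ F) := by
          rw [hprod, hT, eweight_ofFn hp]; ring
        have h2 : r ^ (1 + s) * L ^ F * (f T : ℝ≥0∞) ≤ L ^ (M * M) * (f T : ℝ≥0∞) := by
          rcases eq_or_ne (f T) 0 with h0 | h0
          · simp [h0]
          · refine mul_le_mul_left ?_ _
            have h3 : F ≤ M * M := by
              calc F ≤ T.subtreeSum f := by omega
                _ ≤ M * T.size := PTree.subtreeSum_le_mul_size hfM T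
                _ ≤ M * M := Nat.mul_le_mul_left _ (hf T h0)
            calc r ^ (1 + s) * L ^ F ≤ 1 * L ^ (M * M) :=
                  mul_le_mul' (pow_le_one₀ zero_le hr) (pow_le_pow_right₀ hL h3)
              _ = _ := one_mul _
        rw [hw, hsize, hsub]
        calc eweight p T * (r ^ (1 + s) * L ^ (f T + F))
            = eweight p T * (r ^ (1 + s) * L ^ F) * L ^ f T := by rw [pow_add L]; ring
          _ ≤ eweight p T * (r ^ (1 + s) * L ^ F) * (1 + K * f T) :=
              mul_le_mul_right (hK _ (hfM T)) _
          _ = r * (eweight p T * (r ^ s * L ^ F)) +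
                K * eweight p T * (r ^ (1 + s) * L ^ F * f T) := by rw [pow_add r 1]; ring
          _ ≤ r * (eweight p T * (r ^ s * L ^ F)) +
                K * eweight p T * (L ^ (M * M) * f T) := by gcongr
          _ = _ := by ring
      · exact zero_le
    calc _ ≤ ∑' c, ∑' x : Fin c → PTree, (r * (ENNReal.ofReal (p c) * ∏ i, v (x i)) +
          K * L ^ (M * M) *
            (eweight p (.node (List.ofFn x)) * (f (.node (List.ofFn x)) : ℝ≥0∞))) := by
          rw [PTree.tsum_eq_tsum_tuple]
          exact ENNReal.tsum_le_tsum fun c => ENNReal.tsum_le_tsum fun x => key c x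
      _ = r * ∑' c, ENNReal.ofReal (p c) * (∑' T, v T) ^ c +
          K * L ^ (M * M) * ∑' T, eweight p T * (f T : ℝ≥0∞) := by
          simp only [ENNReal.tsum_add, ENNReal.tsum_mul_left, tsum_pi_prod]
          rw [PTree.tsum_eq_tsum_tuple fun T => eweight p T * (f T : ℝ≥0∞)]
      _ ≤ r * 1 + K * L ^ (M * M) * ∑' T, eweight p T * (f T : ℝ≥0∞) := by
          gcongr
          refine le_trans (ENNReal.tsum_le_tsum fun c => ?_) hs
          exact mul_le_of_le_one_right zero_le (pow_le_one₀ zero_le ih)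
      _ ≤ 1 := by rwa [mul_one]

lemma tsum_eweight_le_one (hp : ∀ i, 0 ≤ p i) (hs : ∑' c, ENNReal.ofReal (p c) ≤ 1) :
    ∑' T, eweight p T ≤ 1 := by
  rw [ENNReal.tsum_eq_iSup_sum]
  refine iSup_le fun s => ?_
  refine le_trans ?_ (tsum_exp_subtreeSum_le hp hs (L := 1) (r := 1) (K := 0) (M := 0)
    (f := fun _ => 0) (by simp) (by simp) le_rfl le_rfl (by simp) (by simp) (s.sup PTree.size))
  refine le_trans (Finset.sum_le_sum fun T hT => ?_) (ENNReal.sum_le_tsum s)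
  rw [if_pos (Finset.le_sup hT)]
  simp

lemma tsum_subtreeSum_ge_le_exp (hp : ∀ i, 0 ≤ p i) (hs : ∑' c, ENNReal.ofReal (p c) ≤ 1)
    {M : ℕ} {f : PTree → ℕ} (hf : ∀ T, f T ≠ 0 → T.size ≤ M) (hfM : ∀ T, f T ≤ M)
    (hδ : ∑' T, eweight p T * (f T : ℝ≥0∞) ≤ ENNReal.ofReal (1 / 48)) :
    ∃ ℓ : ℝ, 0 < ℓ ∧ ∀ n : ℕ, ∑' T : PTree,
      (if T.size = n ∧ n ≤ 4 * T.subtreeSum f then eweight p T else 0) ≤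
        ENNReal.ofReal (Real.exp (-ℓ * n)) := by
  set l : ℝ := 1 / ((M : ℝ) * M + M + 1) with hl
  have hl0 : 0 < l := by positivity
  have hlM : l * (M + M * M) ≤ 1 := by
    rw [hl, div_mul_eq_mul_div, div_le_one (by positivity)]; linarith
  have hl1 : l ≤ 1 := by
    rw [hl, div_le_one (by positivity)]
    nlinarith [Nat.cast_nonneg (α := ℝ) M]
  have hpow : ∀ m : ℕ, ENNReal.ofReal (Real.exp l) ^ m = ENNReal.ofReal (Real.exp (l * m)) := by
    intro m
    rw [← ENNReal.ofReal_pow (Real.exp_nonneg _), ← Real.exp_nat_mul, mul_comm]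
  have hpow' : ∀ m : ℕ, ENNReal.ofReal (Real.exp (-(l / 8))) ^ m =
      ENNReal.ofReal (Real.exp (-(l / 8) * m)) := by
    intro m
    rw [← ENNReal.ofReal_pow (Real.exp_nonneg _), ← Real.exp_nat_mul, mul_comm]
  have main := tsum_exp_subtreeSum_le hp hs (L := ENNReal.ofReal (Real.exp l))
    (r := ENNReal.ofReal (Real.exp (-(l / 8)))) (K := ENNReal.ofReal (l * Real.exp (l * M))) hf hfM
    (by rw [ENNReal.ofReal_le_one, Real.exp_le_one_iff]; linarith)
    (by rw [ENNReal.one_le_ofReal, Real.one_le_exp_iff]; exact hl0.le)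
    (by
      intro m hm
      rw [hpow, ← ENNReal.ofReal_natCast, ← ENNReal.ofReal_mul (by positivity), ← ENNReal.ofReal_one,
        ← ENNReal.ofReal_add (by norm_num) (by positivity)]
      refine ENNReal.ofReal_le_ofReal ?_
      have h1 : Real.exp (l * m) ≤ 1 + l * m * Real.exp (l * m) := by
        have h2 := Real.add_one_le_exp (-(l * m))
        have h3 : Real.exp (-(l * m)) * Real.exp (l * m) = 1 := by rw [← Real.exp_add]; simp
        nlinarith [Real.exp_pos (l * m)]
      have h4 : Real.exp (l * m) ≤ Real.exp (l * M) := by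
        refine Real.exp_le_exp.2 (mul_le_mul_of_nonneg_left (by exact_mod_cast hm) hl0.le)
      calc _ ≤ 1 + l * m * Real.exp (l * m) := h1
        _ ≤ 1 + l * m * Real.exp (l * M) := by gcongr
        _ = _ := by ring)
    (by
      refine (add_le_add_right (mul_le_mul_right hδ _) _).trans ?_
      rw [hpow, ← ENNReal.ofReal_mul (by positivity), ← ENNReal.ofReal_mul (by positivity),
        ← ENNReal.ofReal_add (by positivity) (by positivity), ENNReal.ofReal_le_one]
      have h1 : l * Real.exp (l * M) * Real.exp (l * (M * M : ℕ)) ≤ l * 3 := by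
        rw [mul_assoc, ← Real.exp_add]
        gcongr
        calc Real.exp (l * M + l * (M * M : ℕ)) ≤ Real.exp 1 := by
              refine Real.exp_le_exp.2 ?_
              push_cast; linarith
          _ ≤ 3 := by linarith [Real.exp_one_lt_d9]
      have h2 : Real.exp (-(l / 8)) ≤ 1 - l / 16 := by
        have h3 := Real.add_one_le_exp (l / 8)
        have h4 : Real.exp (-(l / 8)) * Real.exp (l / 8) = 1 := by rw [← Real.exp_add]; simp
        have h5 := Real.exp_pos (-(l / 8))
        have h6 : Real.exp (-(l / 8)) * (l / 8 + 1) ≤ 1 := by nlinarith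
        by_contra! h7
        nlinarith
      linarith)
  refine ⟨l / 8, by positivity, fun n => ?_⟩
  calc _ ≤ ∑' T : PTree, ENNReal.ofReal (Real.exp (-(l / 8) * n)) * (if T.size ≤ n then
        eweight p T * (ENNReal.ofReal (Real.exp (-(l / 8))) ^ T.size *
          ENNReal.ofReal (Real.exp l) ^ T.subtreeSum f) else 0) := by
        refine ENNReal.tsum_le_tsum fun T => ?_
        split_ifs with h1 h2
        · rw [hpow, hpow', h1.1, mul_left_comm, ← ENNReal.ofReal_mul (by positivity),
            ← ENNReal.ofReal_mul (by positivity), ← Real.exp_add, ← Real.exp_add]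
          refine le_mul_of_one_le_right zero_le ?_
          rw [ENNReal.one_le_ofReal, Real.one_le_exp_iff]
          have h3 : (n : ℝ) ≤ 4 * T.subtreeSum f := by exact_mod_cast h1.2
          nlinarith
        · exact absurd h1.1.le h2
        · exact zero_le
        · exact zero_le
    _ ≤ _ := by
        rw [ENNReal.tsum_mul_left]
        exact mul_le_of_le_one_right zero_le (main n)

end

/-- The tail of the series `∑ k ^ (-5/4)`. -/
noncomputable def rpowTail (M : ℕ) : ℝ := ∑' k : ℕ, if M < k then (k : ℝ) ^ (-(5 / 4) : ℝ) else 0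

lemma summable_rpowTail (M : ℕ) :
    Summable fun k : ℕ => if M < k then (k : ℝ) ^ (-(5 / 4) : ℝ) else 0 := by
  refine Summable.of_nonneg_of_le (fun k => ?_) (fun k => ?_)
    (Real.summable_nat_rpow.2 (by norm_num : (-(5 / 4) : ℝ) < -1))
  · split_ifs <;> positivity
  · split_ifs
    · rfl
    · positivity

lemma rpowTail_nonneg (M : ℕ) : 0 ≤ rpowTail M :=
  tsum_nonneg fun k => by split_ifs <;> positivity

lemma tendsto_rpowTail : Tendsto rpowTail atTop (nhds 0) := by
  have h := (tendsto_sum_nat_add fun k : ℕ => (k : ℝ) ^ (-(5 / 4) : ℝ)).comp (tendsto_add_atTop_nat 1)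
  refine h.congr fun M => ?_
  rw [rpowTail, ← (summable_rpowTail M).sum_add_tsum_nat_add (M + 1), Finset.sum_eq_zero, zero_add]
  · refine tsum_congr fun k => ?_
    rw [if_pos (by omega)]
  · intro k hk
    rw [if_neg]
    have := Finset.mem_range.1 hk
    omega

lemma sum_range_one_div_sqrt_le (n : ℕ) :
    ∑ i ∈ Finset.range n, 1 / √((i : ℝ) + 1) ≤ 2 * √n := by
  induction n with
  | zero => simp
  | succ n ih =>
    rw [Finset.sum_range_succ]
    push_cast
    have h1 : 0 < √((n : ℝ) + 1) := by positivity
    have h2 : √(n : ℝ) ^ 2 = n := Real.sq_sqrt (by positivity)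
    have h3 : √((n : ℝ) + 1) ^ 2 = n + 1 := Real.sq_sqrt (by positivity)
    have h4 : 1 / √((n : ℝ) + 1) ≤ 2 * √((n : ℝ) + 1) - 2 * √n := by
      rw [div_le_iff₀ h1]
      nlinarith [sq_nonneg (√((n : ℝ) + 1) - √n)]
    linarith

lemma rpow_mul_one_div_sqrt_le {n k m : ℕ} (hk : 1 ≤ k) (h : k + m = n) :
    (k : ℝ) ^ (-(5 / 4) : ℝ) * (1 / √((m : ℝ) + 1)) ≤
      2 / √n * (k : ℝ) ^ (-(5 / 4) : ℝ) + 4 * (n : ℝ) ^ (-(5 / 4) : ℝ) * (1 / √((m : ℝ) + 1)) := by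
  have hk' : (0 : ℝ) < k := by exact_mod_cast hk
  have hn' : (0 : ℝ) < n := by exact_mod_cast (by omega : 0 < n)
  by_cases hkm : k ≤ m
  · have h1 : 1 / √((m : ℝ) + 1) ≤ 2 / √n := by
      rw [div_le_div_iff₀ (by positivity) (by positivity), one_mul]
      refine Real.sqrt_le_iff.2 ⟨by positivity, ?_⟩
      rw [mul_pow, Real.sq_sqrt (by positivity)]
      have : (n : ℝ) ≤ 4 * (m + 1) := by exact_mod_cast (by omega : n ≤ 4 * (m + 1))
      linarith
    have h2 : 0 ≤ 4 * (n : ℝ) ^ (-(5 / 4) : ℝ) * (1 / √((m : ℝ) + 1)) := by positivity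
    calc _ ≤ (k : ℝ) ^ (-(5 / 4) : ℝ) * (2 / √n) := by gcongr
      _ ≤ _ := by linarith
  · have h1 : (k : ℝ) ^ (-(5 / 4) : ℝ) ≤ 4 * (n : ℝ) ^ (-(5 / 4) : ℝ) := by
      have h3 : (n : ℝ) / 2 ≤ k := by
        rw [div_le_iff₀ (by norm_num)]
        exact_mod_cast (by omega : n ≤ k * 2)
      calc _ ≤ ((n : ℝ) / 2) ^ (-(5 / 4) : ℝ) :=
            Real.rpow_le_rpow_of_nonpos (by positivity) h3 (by norm_num)
        _ = (2 : ℝ) ^ (5 / 4 : ℝ) * (n : ℝ) ^ (-(5 / 4) : ℝ) := by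
            rw [Real.div_rpow hn'.le (by norm_num), Real.rpow_neg (by norm_num : (0 : ℝ) ≤ 2),
              div_inv_eq_mul, mul_comm]
        _ ≤ _ := by
            gcongr
            calc (2 : ℝ) ^ (5 / 4 : ℝ) ≤ (2 : ℝ) ^ (2 : ℝ) :=
                  Real.rpow_le_rpow_of_exponent_le (by norm_num) (by norm_num)
              _ = 4 := by norm_num
    have h2 : 0 ≤ 2 / √n * (k : ℝ) ^ (-(5 / 4) : ℝ) := by positivity
    calc _ ≤ 4 * (n : ℝ) ^ (-(5 / 4) : ℝ) * (1 / √((m : ℝ) + 1)) := by gcongr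
      _ ≤ _ := by linarith

section

variable {p : ℕ → ℝ} {C C' : ℝ}

lemma coeff_ite_size (M k : ℕ) (u : PTree → ℝ≥0∞) (g : PTree → ℕ) :
    PowerSeries.coeff k (sizeSeries PTree.size fun T =>
      u T * ((if M < T.size then g T else 0 : ℕ) : ℝ≥0∞)) =
      if M < k then PowerSeries.coeff k (sizeSeries PTree.size fun T => u T * (g T : ℝ≥0∞))
        else 0 := by
  simp only [coeff_sizeSeries]
  split_ifs with h
  · refine tsum_congr fun T => ?_
    split_ifs with h1 h2
    · rfl
    · omega
    · rfl
  · rw [ENNReal.tsum_eq_zero]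
    intro T
    split_ifs with h1 h2
    · omega
    · simp
    · rfl

lemma coeff_subtreeSum_large_le (hp : ∀ i, 0 ≤ p i) {g : PTree → ℕ} (hC0 : 0 ≤ C) (hC'0 : 0 ≤ C')
    (ha : ∀ m, powCoeff p m m ≤ C * (1 / √((m : ℝ) + 1)))
    (he : ∀ k, 2 ≤ k → PowerSeries.coeff k (sizeSeries PTree.size fun T =>
      eweight p T * (g T : ℝ≥0∞)) ≤ ENNReal.ofReal (C' * (k : ℝ) ^ (-(5 / 4) : ℝ)))
    {M n : ℕ} (hM : 1 ≤ M) (hn : 1 ≤ n) :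
    PowerSeries.coeff n (sizeSeries PTree.size fun T => eweight p T *
      (T.subtreeSum (fun S => if M < S.size then g S else 0) : ℝ≥0∞)) ≤
      ENNReal.ofReal (C * C' * (2 / √n * rpowTail M + 16 * (n : ℝ) ^ (-(5 / 4) : ℝ) * √n)) := by
  have hn' : (1 : ℝ) ≤ n := by exact_mod_cast hn
  rw [coeff_subtreeSum hp]
  calc _ ≤ ∑ x ∈ Finset.HasAntidiagonal.antidiagonal n, ENNReal.ofReal (C * C' *
        (2 / √n * (if M < x.1 then (x.1 : ℝ) ^ (-(5 / 4) : ℝ) else 0) +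
          4 * (n : ℝ) ^ (-(5 / 4) : ℝ) * (1 / √((x.2 : ℝ) + 1)))) := by
        refine Finset.sum_le_sum fun x hx => ?_
        rw [coeff_ite_size, shiftCoeff_zero_ofReal hp]
        split_ifs with h
        · calc _ ≤ ENNReal.ofReal (C' * (x.1 : ℝ) ^ (-(5 / 4) : ℝ)) *
                ENNReal.ofReal (C * (1 / √((x.2 : ℝ) + 1))) :=
                mul_le_mul' (he _ (by omega)) (ENNReal.ofReal_le_ofReal (ha _))
            _ = ENNReal.ofReal (C * C' * ((x.1 : ℝ) ^ (-(5 / 4) : ℝ) * (1 / √((x.2 : ℝ) + 1)))) := by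
                rw [← ENNReal.ofReal_mul (by positivity)]
                congr 1; ring
            _ ≤ _ := by
                refine ENNReal.ofReal_le_ofReal (mul_le_mul_of_nonneg_left ?_ (by positivity))
                exact rpow_mul_one_div_sqrt_le (by omega) (Finset.HasAntidiagonal.mem_antidiagonal.1 hx)
        · rw [zero_mul]; exact zero_le
    _ = ENNReal.ofReal (∑ x ∈ Finset.HasAntidiagonal.antidiagonal n, C * C' *
        (2 / √n * (if M < x.1 then (x.1 : ℝ) ^ (-(5 / 4) : ℝ) else 0) +
          4 * (n : ℝ) ^ (-(5 / 4) : ℝ) * (1 / √((x.2 : ℝ) + 1)))) := by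
        rw [ENNReal.ofReal_sum_of_nonneg]
        intro x _
        split_ifs <;> positivity
    _ ≤ _ := by
        refine ENNReal.ofReal_le_ofReal ?_
        rw [← Finset.mul_sum, Finset.sum_add_distrib, ← Finset.mul_sum, ← Finset.mul_sum]
        have h1 : ∑ x ∈ Finset.HasAntidiagonal.antidiagonal n,
            (if M < x.1 then (x.1 : ℝ) ^ (-(5 / 4) : ℝ) else 0) ≤ rpowTail M := by
          rw [Finset.Nat.sum_antidiagonal_eq_sum_range_succ_mk]
          exact (summable_rpowTail M).sum_le_tsum _ fun k _ => by split_ifs <;> positivity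
        have h2 : ∑ x ∈ Finset.HasAntidiagonal.antidiagonal n, 1 / √((x.2 : ℝ) + 1) ≤ 4 * √n := by
          rw [← Finset.Nat.sum_antidiagonal_swap]
          simp only [Prod.snd_swap]
          rw [Finset.Nat.sum_antidiagonal_eq_sum_range_succ_mk]
          refine (sum_range_one_div_sqrt_le _).trans ?_
          have h3 : √((n.succ : ℕ) : ℝ) ≤ 2 * √n := by
            refine Real.sqrt_le_iff.2 ⟨by positivity, ?_⟩
            rw [mul_pow, Real.sq_sqrt (by positivity)]
            push_cast; linarith
          linarith
        refine mul_le_mul_of_nonneg_left ?_ (by positivity)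
        calc _ ≤ 2 / √n * rpowTail M + 4 * (n : ℝ) ^ (-(5 / 4) : ℝ) * (4 * √n) := by gcongr
          _ = _ := by ring

lemma tsum_large_le {g : PTree → ℕ} (hC'0 : 0 ≤ C')
    (he : ∀ k, 2 ≤ k → PowerSeries.coeff k (sizeSeries PTree.size fun T =>
      eweight p T * (g T : ℝ≥0∞)) ≤ ENNReal.ofReal (C' * (k : ℝ) ^ (-(5 / 4) : ℝ)))
    {M : ℕ} (hM : 1 ≤ M) :
    ∑' T, eweight p T * ((if M < T.size then g T else 0 : ℕ) : ℝ≥0∞) ≤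
      ENNReal.ofReal (C' * rpowTail M) := by
  rw [← tsum_coeff_sizeSeries PTree.size, rpowTail, ← tsum_mul_left, ENNReal.ofReal_tsum_of_nonneg]
  · refine ENNReal.tsum_le_tsum fun k => ?_
    rw [coeff_ite_size]
    split_ifs
    · exact he _ (by omega)
    · exact zero_le
  · intro k; split_ifs <;> positivity
  · exact (summable_rpowTail M).mul_left _

end

lemma PTree.subtreeSum_le_add {f g₁ g₂ : PTree → ℕ} (h : ∀ T, f T ≤ g₁ T + g₂ T) (T : PTree) :
    T.subtreeSum f ≤ T.subtreeSum g₁ + T.subtreeSum g₂ := by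
  induction T using PTree.induction_ofFn with
  | h c x ih =>
    have h1 := h (.node (List.ofFn x))
    have h2 := Finset.sum_le_sum fun i (_ : i ∈ Finset.univ) => ih i
    rw [Finset.sum_add_distrib] at h2
    simp only [subtreeSum_ofFn]
    omega

lemma tsum_subtype_weight {p : ℕ → ℝ} (hp : ∀ i, 0 ≤ p i) (Q : PTree → Prop) [DecidablePred Q] :
    ∑' T : {T : PTree // Q T}, weight p T.1 = (∑' T, if Q T then eweight p T else 0).toReal := by
  have h := tsum_subtype {T | Q T} (eweight p)
  have h2 : ∑' T, (if Q T then eweight p T else 0) = ∑' T : {T : PTree // Q T}, eweight p T.1 := by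
    refine Eq.trans (tsum_congr fun T => ?_) h.symm
    simp [Set.indicator]
  rw [h2, ENNReal.tsum_toReal_eq (f := fun T : {T : PTree // Q T} => eweight p T.1)
    fun _ => ENNReal.ofReal_ne_top]
  exact tsum_congr fun T => (ENNReal.toReal_ofReal (weight_nonneg hp _)).symm

lemma treeSum_eq {p : ℕ → ℝ} (hp : ∀ i, 0 ≤ p i) {n : ℕ} (hn : 1 ≤ n) :
    treeSum p n = powCoeff p n (n - 1) / n := by
  rw [treeSum, tsum_subtype_weight hp fun T => T.size = n, ← coeff_sizeSeries, ← treeSeries,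
    coeff_treeSeries hp hn,
    ENNReal.toReal_ofReal (div_nonneg (powCoeff_nonneg hp _ _) (Nat.cast_nonneg _))]

open Classical in
lemma le_condProb {p : ℕ → ℝ} (hp : ∀ i, 0 ≤ p i) {n : ℕ} (hn : n ∈ gwSupport p)
    {A : PTree → Prop} {ε : ℝ} (hε : 0 ≤ ε)
    (h : ∑' T, (if T.size = n ∧ ¬ A T then eweight p T else 0) ≤ ENNReal.ofReal (ε * treeSum p n)) :
    1 - ε ≤ condProb p n A ∧ condProb p n A ≤ 1 := by
  have hpos := hn.2
  have h1 := tsum_subtype_weight hp fun T => T.size = n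
  have h2 := tsum_subtype_weight hp fun T => T.size = n ∧ A T
  have hfin : ∑' T, (if T.size = n then eweight p T else 0) ≠ ∞ := by
    rw [← coeff_sizeSeries, ← treeSeries, coeff_treeSeries hp hn.1]
    exact ENNReal.ofReal_ne_top
  have h3 : ∑' T, (if T.size = n then eweight p T else 0) =
      ∑' T, (if T.size = n ∧ A T then eweight p T else 0) +
        ∑' T, (if T.size = n ∧ ¬ A T then eweight p T else 0) := by
    rw [← ENNReal.tsum_add]
    refine tsum_congr fun T => ?_
    by_cases hT : T.size = n <;> by_cases hA : A T <;> simp [hT, hA]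
  have h4 : ∑' T, (if T.size = n ∧ A T then eweight p T else 0) ≠ ∞ :=
    ne_top_of_le_ne_top hfin (h3 ▸ le_self_add)
  have h5 : ∑' T, (if T.size = n ∧ ¬ A T then eweight p T else 0) ≠ ∞ :=
    ne_top_of_le_ne_top ENNReal.ofReal_ne_top h
  have h6 := ENNReal.toReal_le_of_le_ofReal (by positivity) h
  have h7 := congrArg ENNReal.toReal h3
  rw [ENNReal.toReal_add h4 h5, ← h1, ← h2] at h7
  have h8 := ENNReal.toReal_nonneg (a := ∑' T, (if T.size = n ∧ ¬ A T then eweight p T else 0))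
  change treeSum p n = _ at h7
  rw [condProb, le_div_iff₀ hpos, div_le_one hpos]
  constructor <;> linarith

lemma tsum_markov (u : PTree → ℝ≥0∞) (S : PTree → ℕ) {n : ℕ} (hn : 1 ≤ n) :
    ∑' T, (if T.size = n ∧ n ≤ 4 * S T then u T else 0) ≤ ENNReal.ofReal (4 / n) *
      PowerSeries.coeff n (sizeSeries PTree.size fun T => u T * (S T : ℝ≥0∞)) := by
  have hn' : (0 : ℝ) < n := by exact_mod_cast hn
  rw [coeff_sizeSeries, ← ENNReal.tsum_mul_left]
  refine ENNReal.tsum_le_tsum fun T => ?_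
  split_ifs with h1 h2
  · rw [mul_left_comm, ← ENNReal.ofReal_natCast, ← ENNReal.ofReal_mul (by positivity)]
    refine le_mul_of_one_le_right zero_le ?_
    rw [ENNReal.one_le_ofReal, div_mul_eq_mul_div, one_le_div hn']
    exact_mod_cast h1.2
  · exact absurd h1.1 h2
  · exact zero_le
  · exact zero_le

open Classical in
lemma tsum_small_heavySize_le (u : PTree → ℝ≥0∞) {K n : ℕ} {f g : PTree → ℕ}
    (hfg : ∀ T, (if K < PTree.lightMass 2 T then PTree.lightMass 2 T else 0) ≤ f T + g T) :
    ∑' T, (if T.size = n ∧ ¬ (1 / (2 * (1 + (K : ℝ))) * n ≤ heavySize 2 T) then u T else 0) ≤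
      ∑' T, (if T.size = n ∧ n ≤ 4 * T.subtreeSum f then u T else 0) +
        ∑' T, (if T.size = n ∧ n ≤ 4 * T.subtreeSum g then u T else 0) := by
  rw [← ENNReal.tsum_add]
  refine ENNReal.tsum_le_tsum fun T => ?_
  by_cases h : T.size = n ∧ ¬ (1 / (2 * (1 + (K : ℝ))) * n ≤ heavySize 2 T)
  · rw [if_pos h]
    have h1 := PTree.size_le_heavySize_add 2 K T
    have h2 := PTree.subtreeSum_le_add hfg T
    have h3 : 2 * ((1 + K) * heavySize 2 T) < n := by
      have h4 := not_le.1 h.2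
      rw [one_div, ← div_eq_inv_mul, lt_div_iff₀ (by positivity)] at h4
      have h5 : (2 * ((1 + K) * heavySize 2 T) : ℝ) < n := by linarith
      exact_mod_cast h5
    rw [h.1] at h1
    by_cases h6 : n ≤ 4 * T.subtreeSum f
    · rw [if_pos ⟨h.1, h6⟩]; exact le_self_add
    · rw [if_pos (⟨h.1, by omega⟩ : T.size = n ∧ n ≤ 4 * T.subtreeSum g)]; exact le_add_self
  · rw [if_neg h]; exact zero_le

open Classical in
lemma exists_tsum_small_heavySize_le {p : ℕ → ℝ} (hp : ∀ i, 0 ≤ p i)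
    (hs : ∑' c, ENNReal.ofReal (p c) ≤ 1) {C C' c : ℝ} (hC0 : 0 ≤ C) (hC'0 : 0 ≤ C') (hc : 0 < c)
    (ha : ∀ m, powCoeff p m m ≤ C * (1 / √((m : ℝ) + 1)))
    (he : ∀ k, 2 ≤ k → PowerSeries.coeff k (sizeSeries PTree.size fun T =>
      eweight p T * (PTree.lightMass 2 T : ℝ≥0∞)) ≤ ENNReal.ofReal (C' * (k : ℝ) ^ (-(5 / 4) : ℝ)))
    (ht : ∀ᶠ n : ℕ in atTop, n ∈ gwSupport p → c / (n * √n) ≤ treeSum p n) :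
    ∃ K : ℕ, ∀ ε : ℝ, 0 < ε → ∀ᶠ n : ℕ in atTop, n ∈ gwSupport p →
      ∑' T, (if T.size = n ∧ ¬ (1 / (2 * (1 + (K : ℝ))) * n ≤ heavySize 2 T)
        then eweight p T else 0) ≤ ENNReal.ofReal (ε * treeSum p n) := by
  have htail : ∀ A δ : ℝ, 0 < δ → ∃ M : ℕ, 1 ≤ M ∧ A * rpowTail M < δ := by
    intro A δ hδ
    have h1 := tendsto_rpowTail.const_mul A
    rw [mul_zero] at h1
    exact ((eventually_ge_atTop 1).and (h1.eventually_lt_const hδ)).exists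
  obtain ⟨K, hK1, hK⟩ := htail C' (1 / 48) (by norm_num)
  refine ⟨K, fun ε hε => ?_⟩
  obtain ⟨M, hM1, hM⟩ := htail (8 * (C * C')) (ε * c / 2) (by positivity)
  set G := PTree.lightMass 2 with hG
  set f : PTree → ℕ := fun T => if M < T.size then 0 else if K < G T then G T else 0 with hf
  set g : PTree → ℕ := fun T => if M < T.size then G T else 0 with hg
  have hfg : ∀ T, (if K < G T then G T else 0) ≤ f T + g T := by
    intro T; simp only [hf, hg]; split_ifs <;> omega
  have hGs : ∀ T, G T ≤ T.size := PTree.lightMass_le_size 2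
  obtain ⟨l, hl, hexp⟩ := tsum_subtreeSum_ge_le_exp hp hs (M := M) (f := f)
    (fun T hT => by
      by_contra! h
      exact hT (if_pos h))
    (fun T => by
      have := hGs T
      simp only [hf]; split_ifs <;> omega)
    (by
      refine le_trans (ENNReal.tsum_le_tsum fun T => ?_) ((tsum_large_le hC'0 he hK1).trans
        (ENNReal.ofReal_le_ofReal hK.le))
      refine mul_le_mul_right (Nat.cast_le.2 ?_) _
      have := hGs T
      simp only [hf]; split_ifs <;> omega)
  have hlim : Tendsto (fun n : ℕ => (n : ℝ) ^ (3 / 2 : ℝ) * Real.exp (-l * n) +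
      8 * (C * C') * rpowTail M + 64 * (C * C') * (n : ℝ) ^ (-(1 / 4) : ℝ)) atTop
      (nhds (0 + 8 * (C * C') * rpowTail M + 64 * (C * C') * 0)) := by
    refine Tendsto.add (Tendsto.add ?_ tendsto_const_nhds) (Tendsto.const_mul _ ?_)
    · exact (tendsto_rpow_mul_exp_neg_mul_atTop_nhds_zero (3 / 2) l hl).comp
        tendsto_natCast_atTop_atTop
    · exact (tendsto_rpow_neg_atTop (by norm_num)).comp tendsto_natCast_atTop_atTop
  have hev := hlim.eventually_lt_const (u := ε * c) (by
    have : 0 < ε * c := by positivity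
    linarith)
  filter_upwards [hev, ht, eventually_ge_atTop 1] with n hn1 hn2 hn hsup
  have hn' : (0 : ℝ) < n := by exact_mod_cast hn
  have hT := rpowTail_nonneg M
  refine (tsum_small_heavySize_le _ hfg).trans ?_
  refine (add_le_add (hexp n) ((tsum_markov _ _ hn).trans (mul_le_mul_right
    (coeff_subtreeSum_large_le hp hC0 hC'0 ha he hM1 hn) _))).trans ?_
  rw [← ENNReal.ofReal_mul (by positivity), ← ENNReal.ofReal_add (by positivity) (by positivity)]
  refine ENNReal.ofReal_le_ofReal ?_
  have hs0 : 0 < √(n : ℝ) := by positivity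
  have hsq : √(n : ℝ) * √n = n := Real.mul_self_sqrt hn'.le
  have h32 : (n : ℝ) ^ (3 / 2 : ℝ) = n * √n := by
    rw [Real.sqrt_eq_rpow, ← Real.rpow_one_add' hn'.le (by norm_num)]; norm_num
  have h14 : (n : ℝ) ^ (-(5 / 4) : ℝ) * n = (n : ℝ) ^ (-(1 / 4) : ℝ) := by
    rw [← Real.rpow_add_one hn'.ne']; norm_num
  calc Real.exp (-l * n) + 4 / n * (C * C' * (2 / √n * rpowTail M +
        16 * (n : ℝ) ^ (-(5 / 4) : ℝ) * √n))
      = ((n : ℝ) ^ (3 / 2 : ℝ) * Real.exp (-l * n) + 8 * (C * C') * rpowTail M +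
          64 * (C * C') * (n : ℝ) ^ (-(1 / 4) : ℝ)) / (n * √n) := by
        rw [h32, ← h14]
        field_simp
        linear_combination (64 * C * C' * (n : ℝ) ^ (-(5 / 4) : ℝ)) * hsq
    _ ≤ ε * c / (n * √n) := by gcongr
    _ = ε * (c / (n * √n)) := by ring
    _ ≤ _ := mul_le_mul_of_nonneg_left (hn2 hsup) hε.le

/-- with high probability the 2-heavy tree of `τ_n` has linear size. -/
theorem stmt_10 (p : ℕ → ℝ)
    (hp_nonneg : ∀ i, 0 ≤ p i)
    (hp_sum : ∑' i : ℕ, p i = 1)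
    (hp_mean : ∑' i : ℕ, (i : ℝ) * p i = 1)
    (hp_sq : Summable (fun i : ℕ => (i : ℝ) ^ 2 * p i))
    (hp_var : 1 < ∑' i : ℕ, (i : ℝ) ^ 2 * p i)
    (hmom : MomentFinite p 5) :
    ∃ υ : ℝ, 0 < υ ∧
      Tendsto (fun n : ℕ => condProb p n (fun T => υ * (n : ℝ) ≤ (heavySize 2 T : ℝ)))
        (atTop ⊓ 𝓟 (gwSupport p)) (nhds 1) := by
  have hsum : HasSum p 1 := by
    have : Summable p := by
      by_contra h
      rw [tsum_eq_zero_of_not_summable h] at hp_sum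
      exact zero_ne_one hp_sum
    exact hp_sum ▸ this.hasSum
  have hmean : HasSum (fun i : ℕ => (i : ℝ) * p i) 1 := by
    have : Summable (fun i : ℕ => (i : ℝ) * p i) := by
      by_contra h
      rw [tsum_eq_zero_of_not_summable h] at hp_mean
      exact zero_ne_one hp_mean
    exact hp_mean ▸ this.hasSum
  obtain ⟨b, hb, hpb⟩ : ∃ b, b ≠ 0 ∧ 0 < p b := by
    by_contra! h
    have : ∀ i : ℕ, (i : ℝ) * p i = 0 := by
      intro i
      rcases eq_or_ne i 0 with rfl | hi
      · simp
      · rw [le_antisymm (h i hi) (hp_nonneg i), mul_zero]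
    simp [this] at hp_mean
  have h0 : 0 < p 0 := by
    refine lt_of_le_of_ne (hp_nonneg 0) fun h => ?_
    have h1 : HasSum (fun i : ℕ => (i : ℝ) * p i - p i) 0 := by simpa using hmean.sub hsum
    have h2 : ∀ i : ℕ, 0 ≤ (i : ℝ) * p i - p i := by
      intro i
      rcases Nat.eq_zero_or_pos i with rfl | hi
      · simp [← h]
      · have h3 : (1 : ℝ) ≤ i := by exact_mod_cast hi
        nlinarith [hp_nonneg i]
    have h4 := (hasSum_zero_iff_of_nonneg h2).1 h1
    have h5 : ∀ i : ℕ, (i : ℝ) ^ 2 * p i = i * p i := by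
      intro i
      have h6 : (i : ℝ) * p i - p i = 0 := congrFun h4 i
      linear_combination (i : ℝ) * h6
    simp only [h5, hp_mean] at hp_var
    exact lt_irrefl _ hp_var
  set V := ∑' i : ℕ, (i : ℝ) ^ 2 * p i with hV
  have hσ : 0 < √(V - 1) := Real.sqrt_pos.2 (by linarith)
  have hvar : HasSum (fun i : ℕ => (i : ℝ) ^ 2 * p i) (1 + √(V - 1) ^ 2) := by
    rw [Real.sq_sqrt (by linarith), add_sub_cancel]
    exact hp_sq.hasSum
  have hs : ∑' c, ENNReal.ofReal (p c) ≤ 1 := by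
    rw [← ENNReal.ofReal_tsum_of_nonneg hp_nonneg hsum.summable, hp_sum, ENNReal.ofReal_one]
  obtain ⟨h, hh0, hh, κ, hκ, hφ⟩ := exists_norm_natCharFun_le_exp hp_nonneg hsum h0 hb hpb
  obtain ⟨C, hC0, hC⟩ := exists_powCoeff_le hp_nonneg hsum hh0 hh hκ hφ
  obtain ⟨c, hc0, hc⟩ := exists_le_powCoeff hp_nonneg hsum hmean hσ hvar hh0 hh hκ hφ
  have ht : ∀ n, 1 ≤ n → PowerSeries.coeff n (treeSeries p) ≤
      ENNReal.ofReal (C * (n : ℝ) ^ (-(3 / 2) : ℝ)) := by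
    intro n hn
    have hn' : (0 : ℝ) < n := by exact_mod_cast hn
    rw [coeff_treeSeries hp_nonneg hn]
    refine ENNReal.ofReal_le_ofReal ?_
    have h1 : C * (n : ℝ) ^ (-(3 / 2) : ℝ) = C / √n / n := by
      rw [Real.sqrt_eq_rpow, div_div, ← Real.rpow_add_one hn'.ne', Real.rpow_neg hn'.le,
        ← div_eq_mul_inv]
      norm_num
    rw [h1]
    gcongr
    exact hC n _ hn
  obtain ⟨C', hC'0, hC'⟩ := coeff_lightMass_le hp_nonneg hC0.le ht
    (tsum_eweight_le_one hp_nonneg hs) hmom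
  have ha : ∀ m, powCoeff p m m ≤ (2 * C + 1) * (1 / √((m : ℝ) + 1)) := by
    intro m
    rcases Nat.eq_zero_or_pos m with rfl | hm
    · rw [powCoeff_zero]; simp; exact hC0.le
    · have hm' : (1 : ℝ) ≤ m := by exact_mod_cast hm
      refine (hC m m hm).trans ?_
      have h1 : √((m : ℝ) + 1) ≤ 2 * √m := by
        refine Real.sqrt_le_iff.2 ⟨by positivity, ?_⟩
        rw [mul_pow, Real.sq_sqrt (by positivity)]
        linarith
      have h2 : 0 < √(m : ℝ) := by positivity
      rw [mul_one_div, div_le_div_iff₀ h2 (by positivity)]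
      nlinarith
  have hlow : ∀ᶠ n : ℕ in atTop, n ∈ gwSupport p → c / (n * √n) ≤ treeSum p n := by
    filter_upwards [hc] with n hn hsup
    have hn' : (0 : ℝ) < n := by exact_mod_cast hsup.1
    have h1 := treeSum_eq hp_nonneg hsup.1
    have hdvd : h ∣ n - 1 := by
      by_contra hnd
      have h2 := hsup.2
      rw [h1, powCoeff_eq_zero hh hnd, zero_div] at h2
      exact lt_irrefl _ h2
    rw [h1, mul_comm, ← div_div]
    gcongr
    exact hn hdvd
  obtain ⟨K, hK⟩ := exists_tsum_small_heavySize_le hp_nonneg hs (by positivity) hC'0 hc0 ha hC' hlow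
  refine ⟨1 / (2 * (1 + (K : ℝ))), by positivity, ?_⟩
  rw [Metric.tendsto_nhds]
  intro ε hε
  rw [eventually_inf_principal]
  filter_upwards [hK (ε / 2) (by positivity)] with n hn hsup
  obtain ⟨h1, h2⟩ := le_condProb hp_nonneg hsup (by positivity) (hn hsup)
  rw [Real.dist_eq, abs_lt]
  constructor <;> linarith
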